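/- Let Ω ⊆ ℂⁿ be a bounded domain and p ∈ ∂Ω a spherically-extreme boundary point: (1) there exist r₀ > 0 and a C² function ρ : B(p, r₀) → ℝ with nonvanishing gradient such that Ω ∩ B(p, r₀) = {ρ < 0} ∩ B(p, r₀), and (2) there exist c ∈ ℂⁿ and R > 0 with Ω ⊆ B(c, R) and ‖p − c‖ = R. Then lim_{Ω ∋ q → p} σ_Ω(q) = 1; i.e., for every ε > 0 there is r > 0 such that σ_Ω(q) > 1 − ε for all q ∈ Ω ∩ B(p, r). -/

import Mathlib

open Metric Set

/-- The squeezing function of a domain `Ω ⊆ ℂⁿ` at a point `p`. -/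
noncomputable def squeezingFun (n : ℕ) (Ω : Set (EuclideanSpace ℂ (Fin n)))
    (p : EuclideanSpace ℂ (Fin n)) : ℝ :=
  sSup { r : ℝ | 0 < r ∧ ∃ f : EuclideanSpace ℂ (Fin n) → EuclideanSpace ℂ (Fin n),
    DifferentiableOn ℂ f Ω ∧ InjOn f Ω ∧ f '' Ω ⊆ ball 0 1 ∧ f p = 0 ∧ ball 0 r ⊆ f '' Ω }

/-- A slowly varying holomorphic cutoff on the right half-plane: equal to `1` at `0`, almost
positive, and small as soon as the real part is at least `κ`. -/
theorem exists_holomorphic_cutoff {s κ θ : ℝ} (hs : 0 < s) (hκ : 0 < κ) (hθ : 0 < θ) :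
    ∃ χ : ℂ → ℂ, ContinuousAt χ 0 ∧ χ 0 = 1 ∧ (∀ w, χ w ≠ 0) ∧
      ∀ w : ℂ, 0 ≤ w.re → DifferentiableAt ℂ χ w ∧ ‖χ w‖ ≤ 1 ∧
        ‖χ w ^ 2 - ((‖χ w‖ ^ 2 : ℝ) : ℂ)‖ ≤ s ∧ (κ ≤ w.re → ‖χ w‖ ^ 2 ≤ θ) := by
  set σ : ℝ := s / 8 with hσ
  have hσ0 : 0 < σ := by positivity
  obtain ⟨L, hL0, hL⟩ : ∃ L : ℝ, 0 < L ∧ Real.exp (-(2 * σ) * L) ≤ θ := by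
    refine ⟨max 1 (-Real.log θ / (2 * σ)), lt_of_lt_of_le one_pos (le_max_left _ _), ?_⟩
    rw [← Real.le_log_iff_exp_le hθ]
    have h := le_max_right 1 (-Real.log θ / (2 * σ))
    rw [div_le_iff₀ (by positivity)] at h
    linarith
  set M : ℝ := Real.exp L / κ with hM
  have hM0 : 0 < M := by positivity
  have hre : ∀ w : ℂ, 0 ≤ w.re → 1 + M * w.re = (1 + (M : ℂ) * w).re := by
    intro w hw; simp
  have hslit : ∀ w : ℂ, 0 ≤ w.re → (1 + (M : ℂ) * w) ∈ Complex.slitPlane := by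
    intro w hw
    left
    rw [← hre w hw]; positivity
  have hdiff : ∀ w : ℂ, 0 ≤ w.re →
      DifferentiableAt ℂ (fun w : ℂ => Complex.exp (-(σ : ℂ) * Complex.log (1 + M * w))) w := by
    intro w hw
    have := hslit w hw
    fun_prop (disch := assumption)
  have hlog : ∀ w : ℂ, 0 ≤ w.re → Real.log (1 + M * w.re) ≤ (Complex.log (1 + M * w)).re := by
    intro w hw
    rw [Complex.log_re]
    apply Real.log_le_log (by positivity)
    rw [hre w hw]
    exact Complex.re_le_norm _
  refine ⟨fun w => Complex.exp (-(σ : ℂ) * Complex.log (1 + M * w)),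
    (hdiff 0 (by simp)).continuousAt, by simp, fun w => Complex.exp_ne_zero _, ?_⟩
  intro w hw
  have hnorm : ‖Complex.exp (-(σ : ℂ) * Complex.log (1 + M * w))‖
      = Real.exp (-σ * (Complex.log (1 + M * w)).re) := by
    rw [Complex.norm_exp]; simp
  have hnn : 0 ≤ (Complex.log (1 + M * w)).re :=
    le_trans (Real.log_nonneg (by nlinarith [mul_nonneg hM0.le hw])) (hlog w hw)
  have hle1 : ‖Complex.exp (-(σ : ℂ) * Complex.log (1 + M * w))‖ ≤ 1 := by
    rw [hnorm, Real.exp_le_one_iff]; nlinarith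
  refine ⟨hdiff w hw, hle1, ?_, ?_⟩
  · set l := Complex.log (1 + M * w) with hl
    have him : |l.im| ≤ 4 := by
      rw [hl, Complex.log_im]
      exact (Complex.abs_arg_le_pi _).trans Real.pi_le_four
    have hsq : Complex.exp (-(σ : ℂ) * l) ^ 2 =
        ((‖Complex.exp (-(σ : ℂ) * l)‖ ^ 2 : ℝ) : ℂ) *
          Complex.exp (Complex.I * ((-(2 * σ) * l.im : ℝ) : ℂ)) := by
      rw [hnorm]
      push_cast
      rw [← Complex.exp_nat_mul, ← Complex.exp_nat_mul, ← Complex.exp_add]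
      congr 1
      conv_lhs => rw [← Complex.re_add_im l]
      push_cast
      ring
    have hfac : Complex.exp (-(σ : ℂ) * l) ^ 2 - ((‖Complex.exp (-(σ : ℂ) * l)‖ ^ 2 : ℝ) : ℂ)
        = ((‖Complex.exp (-(σ : ℂ) * l)‖ ^ 2 : ℝ) : ℂ) *
          (Complex.exp (Complex.I * ((-(2 * σ) * l.im : ℝ) : ℂ)) - 1) := by
      rw [hsq]; simp only [mul_sub, mul_one]
    rw [hfac, norm_mul]
    have h1 : ‖((‖Complex.exp (-(σ : ℂ) * l)‖ ^ 2 : ℝ) : ℂ)‖ ≤ 1 := by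
      rw [Complex.norm_real, Real.norm_eq_abs, abs_of_nonneg (by positivity)]
      exact pow_le_one₀ (norm_nonneg _) hle1
    have h2 := Real.norm_exp_I_mul_ofReal_sub_one_le (x := -(2 * σ) * l.im)
    have h3 : ‖-(2 * σ) * l.im‖ ≤ s := by
      rw [Real.norm_eq_abs, abs_mul, abs_neg, abs_of_pos (by positivity)]
      nlinarith
    calc _ ≤ 1 * ‖-(2 * σ) * l.im‖ := by gcongr
      _ ≤ s := by linarith
  · intro hκw
    refine le_trans ?_ hL
    rw [hnorm, ← Real.exp_nat_mul]
    apply Real.exp_le_exp.2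
    have : L ≤ Real.log (1 + M * w.re) := by
      rw [Real.le_log_iff_exp_le (by positivity)]
      have : Real.exp L = M * κ := by rw [hM]; field_simp
      nlinarith
    have := this.trans (hlog w hw)
    push_cast
    nlinarith

/-- Near the contact point the sheared normal coordinate `u = w - χ² Q(z)` almost lies in the
right half-plane and almost satisfies the defining inequality of the Siegel domain. -/
theorem siegel_estimate {w q x : ℂ} {t Z s κ c C δ ε : ℝ} (ht0 : 0 ≤ t) (ht1 : t ≤ 1)
    (hx : ‖x - t‖ ≤ s) (hxn : ‖x‖ ≤ 1) (hZ : 0 ≤ Z) (hc0 : 0 < c) (hc1 : c ≤ 1) (hC : 0 ≤ C)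
    (hw : c * Z ≤ w.re) (hq : ‖q‖ ≤ C * Z) (hκ : κ ≤ 1 / 4)
    (hκ0 : 0 ≤ κ) (hs : s * C + κ * (C + 1) ≤ c / 2)
    (hloc : Z + q.re - κ * (‖w‖ + Z) ≤ w.re) (hδ : 0 < δ)
    (hε0 : 0 ≤ ε)
    (hsmall : κ + s * C ≤ ε * (c / (6 * (C + 1))) ^ 2) :
    0 < ‖δ + (w - x * q)‖ ∧
      4 * δ * (t * Z - (w - x * q).re) ≤ ε * ‖δ + (w - x * q)‖ ^ 2 := by
  set u := w - x * q with hu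
  have hs0 : 0 ≤ s := (norm_nonneg _).trans hx
  have hxq : |((x - t) * q).re| ≤ s * (C * Z) := by
    refine (Complex.abs_re_le_norm _).trans ?_
    rw [norm_mul]
    gcongr
  have hure : u.re = w.re - t * q.re - ((x - t) * q).re := by
    simp [hu]; ring
  obtain ⟨hx1, hx2⟩ := abs_le.1 hxq
  set E := κ * (‖w‖ + Z) with hE
  have hE0 : 0 ≤ E := by positivity
  have hup : t * Z - u.re ≤ E + s * C * Z := by
    rw [hure]
    nlinarith [mul_nonneg (sub_nonneg.2 ht1) (le_trans (by positivity) hw : 0 ≤ w.re),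
      mul_le_mul_of_nonneg_left hloc ht0, mul_le_mul_of_nonneg_right ht1 hE0]
  have hlow : c * Z - s * C * Z - E ≤ u.re := by
    rw [hure]
    nlinarith [mul_le_mul_of_nonneg_left hw (sub_nonneg.2 ht1),
      mul_le_mul_of_nonneg_left hloc ht0, mul_le_mul_of_nonneg_right ht1 hE0,
      mul_nonneg (mul_nonneg ht0 hZ) (sub_nonneg.2 hc1)]
  have hwu : ‖w‖ ≤ ‖u‖ + C * Z := by
    have : w = u + x * q := by rw [hu]; ring
    calc ‖w‖ = ‖u + x * q‖ := by rw [← this]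
      _ ≤ ‖u‖ + ‖x * q‖ := norm_add_le _ _
      _ ≤ ‖u‖ + 1 * (C * Z) := by rw [norm_mul]; gcongr
      _ = _ := by ring
  have hEu : E ≤ κ * ‖u‖ + κ * (C + 1) * Z := by
    rw [hE]; nlinarith [mul_le_mul_of_nonneg_left hwu hκ0]
  have hlow' : c / 2 * Z - κ * ‖u‖ ≤ u.re := by
    nlinarith [mul_le_mul_of_nonneg_right hs hZ]
  have hn1 : δ + u.re ≤ ‖δ + u‖ := by
    have := Complex.re_le_norm (δ + u)
    simpa using this
  have hn2 : ‖u‖ - δ ≤ ‖δ + u‖ := by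
    have h := norm_sub_norm_le u (-(δ : ℂ))
    rw [norm_neg, Complex.norm_real, Real.norm_eq_abs, abs_of_pos hδ, sub_neg_eq_add,
      add_comm u] at h
    exact h
  have hu0 := norm_nonneg u
  have hw0 := norm_nonneg w
  have hn3 : δ + c * Z + ‖u‖ / 2 ≤ 3 * ‖δ + u‖ := by
    nlinarith [mul_le_mul_of_nonneg_right hκ hu0]
  set m := c / (2 * (C + 1)) with hm
  have hm0 : 0 < m := by positivity
  have hmC : m * (C + 1) = c / 2 := by rw [hm]; field_simp
  have hm1 : m ≤ 1 / 2 := by nlinarith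
  have hn4 : m * (δ + (‖w‖ + Z)) ≤ 3 * ‖δ + u‖ := by
    have h1 := mul_le_mul_of_nonneg_left hwu hm0.le
    have h2 := mul_le_mul_of_nonneg_right hm1 hu0
    have h3 := mul_le_mul_of_nonneg_right hm1 hδ.le
    have h4 := mul_nonneg hc0.le hZ
    have h5 : m * (C * Z) + m * Z = c / 2 * Z := by rw [← hmC]; ring
    linarith
  have hm3 : c / (6 * (C + 1)) = m / 3 := by rw [hm]; field_simp; norm_num
  have hpos : 0 < m / 3 * (δ + (‖w‖ + Z)) := by positivity
  have hn5 : m / 3 * (δ + (‖w‖ + Z)) ≤ ‖δ + u‖ := by linarith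
  refine ⟨hpos.trans_le hn5, ?_⟩
  have hX : 0 ≤ ‖w‖ + Z := by positivity
  calc 4 * δ * (t * Z - u.re) ≤ 4 * δ * ((κ + s * C) * (‖w‖ + Z)) := by
        gcongr
        have := mul_nonneg (mul_nonneg hs0 hC) hw0
        linarith
    _ ≤ 4 * δ * ((ε * (m / 3) ^ 2) * (‖w‖ + Z)) := by rw [hm3] at hsmall; gcongr
    _ ≤ ε * (m / 3 * (δ + (‖w‖ + Z))) ^ 2 := by
        have := mul_nonneg (mul_nonneg hε0 (sq_nonneg (m / 3)))
          (sq_nonneg (δ - (‖w‖ + Z)))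
        linarith
    _ ≤ ε * ‖δ + u‖ ^ 2 := by gcongr

/-- Away from the contact point the sheared normal coordinate has real part bounded below. -/
theorem siegel_estimate_far {w q x : ℂ} {t Z μ D δ ε : ℝ} (ht1 : t ≤ 1) (hZ : 0 ≤ Z) (hZD : Z ≤ D)
    (hxq : ‖x * q‖ ≤ w.re / 2) (hμ : 0 < μ) (hw : 2 * μ ≤ w.re) (hδ : 0 < δ) (hε : 0 ≤ ε)
    (hδD : 4 * δ * D ≤ ε * μ ^ 2) :
    0 < ‖δ + (w - x * q)‖ ∧
      4 * δ * (t * Z - (w - x * q).re) ≤ ε * ‖δ + (w - x * q)‖ ^ 2 := by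
  have h1 := (Complex.re_le_norm _).trans hxq
  have hure : μ ≤ (w - x * q).re := by rw [Complex.sub_re]; linarith
  have hnorm : μ ≤ ‖δ + (w - x * q)‖ := by
    refine le_trans ?_ (Complex.re_le_norm _)
    rw [Complex.add_re, Complex.ofReal_re]; linarith
  refine ⟨hμ.trans_le hnorm, ?_⟩
  have h2 : t * Z - (w - x * q).re ≤ D := by nlinarith
  calc _ ≤ 4 * δ * D := by gcongr
    _ ≤ ε * μ ^ 2 := hδD
    _ ≤ _ := by gcongr

section SiegelMap

variable {V : Type*} [NormedAddCommGroup V] [InnerProductSpace ℂ V]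

/-- The component of `h` orthogonal to the unit vector `e`. -/
noncomputable def orthPart (e h : V) : V := h - inner ℂ e h • e

theorem inner_orthPart {e : V} (he : ‖e‖ = 1) (h : V) : inner ℂ e (orthPart e h) = 0 := by
  simp [orthPart, inner_self_eq_norm_sq_to_K, he]

theorem norm_sq_smul_add {e z : V} (he : ‖e‖ = 1) (hz : inner ℂ e z = 0) (a : ℂ) :
    ‖a • e + z‖ ^ 2 = ‖a‖ ^ 2 + ‖z‖ ^ 2 := by
  have : inner ℂ (a • e) z = 0 := by rw [inner_smul_left, hz, mul_zero]
  have h := norm_add_sq_eq_norm_sq_add_norm_sq_of_inner_eq_zero (a • e) z this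
  rw [norm_smul, he, mul_one] at h
  nlinarith

theorem norm_sq_eq_orthPart {e : V} (he : ‖e‖ = 1) (h : V) :
    ‖h‖ ^ 2 = ‖inner ℂ e h‖ ^ 2 + ‖orthPart e h‖ ^ 2 := by
  rw [← norm_sq_smul_add he (inner_orthPart he h)]
  simp [orthPart]

/-- The holomorphic coordinate straightening the pluriharmonic quadratic part `B z z` of the
boundary, localized by the cutoff `χ`. -/
noncomputable def shearedCoord (e : V) (B : V →L[ℂ] V →L[ℂ] ℂ) (χ : ℂ → ℂ) (ℓ : V →L[ℂ] ℂ)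
    (h : V) : ℂ :=
  ℓ h - χ (ℓ h) ^ 2 * B (orthPart e h) (orthPart e h)

/-- The shear followed by the parabolic dilation by `δ` and the Cayley transform. -/
noncomputable def siegelMap (e : V) (B : V →L[ℂ] V →L[ℂ] ℂ) (χ : ℂ → ℂ) (ℓ : V →L[ℂ] ℂ)
    (δ : ℝ) (h : V) : V :=
  ((δ - shearedCoord e B χ ℓ h) / (δ + shearedCoord e B χ ℓ h)) • e +
    ((2 * √δ / (δ + shearedCoord e B χ ℓ h)) * χ (ℓ h)) • orthPart e h

variable {e : V} {B : V →L[ℂ] V →L[ℂ] ℂ} {χ : ℂ → ℂ} {ℓ : V →L[ℂ] ℂ} {δ : ℝ}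

theorem norm_sq_siegelMap (he : ‖e‖ = 1) (hδ : 0 < δ) {h : V}
    (hu : (δ : ℂ) + shearedCoord e B χ ℓ h ≠ 0) :
    ‖siegelMap e B χ ℓ δ h‖ ^ 2 = 1 +
      4 * δ * (‖χ (ℓ h)‖ ^ 2 * ‖orthPart e h‖ ^ 2 - (shearedCoord e B χ ℓ h).re) /
        ‖(δ : ℂ) + shearedCoord e B χ ℓ h‖ ^ 2 := by
  have hz : inner ℂ e (((2 * √δ / (δ + shearedCoord e B χ ℓ h)) * χ (ℓ h)) • orthPart e h) = 0 := by
    rw [inner_smul_right, inner_orthPart he, mul_zero]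
  rw [siegelMap, norm_sq_smul_add he hz, norm_smul, norm_mul, norm_div, norm_div]
  set u := shearedCoord e B χ ℓ h
  have hn : ‖(δ : ℂ) + u‖ ≠ 0 := norm_ne_zero_iff.2 hu
  have h1 : ‖(δ : ℂ) - u‖ ^ 2 = ‖(δ : ℂ) + u‖ ^ 2 - 4 * δ * u.re := by
    rw [← Complex.normSq_eq_norm_sq, ← Complex.normSq_eq_norm_sq, Complex.normSq_apply,
      Complex.normSq_apply]
    simp; ring
  have h2 : ‖(2 * √δ : ℂ)‖ ^ 2 = 4 * δ := by
    rw [norm_mul, mul_pow, Complex.norm_real, Real.norm_eq_abs, sq_abs, Real.sq_sqrt hδ.le]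
    norm_num
  rw [div_pow, h1, mul_pow, mul_pow, div_pow, h2]
  field_simp
  ring

theorem injOn_siegelMap (he : ‖e‖ = 1) (hδ : 0 < δ) (hχ : ∀ w, χ w ≠ 0) (hℓ : ℓ e ≠ 0)
    {U : Set V} (hU : ∀ h ∈ U, (δ : ℂ) + shearedCoord e B χ ℓ h ≠ 0) :
    InjOn (siegelMap e B χ ℓ δ) U := by
  intro h hh k hk hhk
  have hδ' : (δ : ℂ) ≠ 0 := by exact_mod_cast hδ.ne'
  have hsδ : (√δ : ℂ) ≠ 0 := by exact_mod_cast (Real.sqrt_pos.2 hδ).ne'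
  have h1 := hU h hh
  have h2 := hU k hk
  have hin : ∀ x, inner ℂ e (siegelMap e B χ ℓ δ x) =
      (δ - shearedCoord e B χ ℓ x) / (δ + shearedCoord e B χ ℓ x) := by
    intro x
    simp [siegelMap, inner_orthPart he,
      inner_self_eq_norm_sq_to_K, he]
  have hueq : shearedCoord e B χ ℓ h = shearedCoord e B χ ℓ k := by
    have h3 := congrArg (inner ℂ e) hhk
    rw [hin, hin, div_eq_div_iff h1 h2] at h3
    have : 2 * (δ : ℂ) * (shearedCoord e B χ ℓ k - shearedCoord e B χ ℓ h) = 0 := by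
      linear_combination h3
    have := (mul_eq_zero.1 this).resolve_left (by simpa using hδ')
    exact (sub_eq_zero.1 this).symm
  have hz : χ (ℓ h) • orthPart e h = χ (ℓ k) • orthPart e k := by
    have h3 := hhk
    simp only [siegelMap, hueq, add_right_inj, mul_smul] at h3
    exact smul_right_injective V (div_ne_zero (mul_ne_zero two_ne_zero hsδ) h2) h3
  have hw : ℓ h = ℓ k := by
    have h3 := hueq
    have hB : ∀ x, χ (ℓ x) ^ 2 * B (orthPart e x) (orthPart e x) =
        B (χ (ℓ x) • orthPart e x) (χ (ℓ x) • orthPart e x) := by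
      intro x; simp; ring
    simp only [shearedCoord, hB] at h3
    rw [hz] at h3
    exact sub_left_inj.1 h3
  rw [hw] at hz
  have hz' : orthPart e h = orthPart e k := smul_right_injective V (hχ _) hz
  have hdec : ∀ x, x = inner ℂ e x • e + orthPart e x := by intro x; simp [orthPart]
  have ha : inner ℂ e h = inner ℂ e k := by
    have h3 := hw
    rw [hdec h, hdec k, map_add, map_add, hz', add_left_inj, map_smul, map_smul, smul_eq_mul,
      smul_eq_mul] at h3
    exact mul_right_cancel₀ hℓ h3
  rw [hdec h, hdec k, ha, hz']

theorem differentiableAt_siegelMap {h : V} (hχ : DifferentiableAt ℂ χ (ℓ h))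
    (hu : (δ : ℂ) + shearedCoord e B χ ℓ h ≠ 0) :
    DifferentiableAt ℂ (siegelMap e B χ ℓ δ) h := by
  have h1 : DifferentiableAt ℂ (fun x => χ (ℓ x)) h := by
    exact DifferentiableAt.comp h hχ ℓ.differentiableAt
  have h2 : DifferentiableAt ℂ (orthPart e) h := by
    have : DifferentiableAt ℂ (fun x => inner ℂ e x) h := (innerSL ℂ e).differentiableAt
    unfold orthPart
    fun_prop
  have h3 : DifferentiableAt ℂ (shearedCoord e B χ ℓ) h := by
    have : DifferentiableAt ℂ (fun x => B (orthPart e x) (orthPart e x)) h :=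
      (B.differentiableAt.comp h h2).clm_apply h2
    unfold shearedCoord
    fun_prop
  unfold siegelMap
  fun_prop (disch := assumption)

/-- Points are recovered from their coordinates: `w` along the functional `ℓ` and `z` in the
orthogonal complement of `e`. -/
theorem siegelMap_coords (he : ‖e‖ = 1) (hℓ : ℓ e ≠ 0) {w : ℂ} {z : V} (hz : inner ℂ e z = 0) :
    ℓ (z + ((w - ℓ z) / ℓ e) • e) = w ∧ orthPart e (z + ((w - ℓ z) / ℓ e) • e) = z := by
  constructor
  · simp [hℓ]
  · simp [orthPart, hz, inner_self_eq_norm_sq_to_K, he]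

theorem norm_inner_le_of_functional_close {τ : ℝ} (hℓ : ‖ℓ - innerSL ℂ e‖ ≤ τ) (h : V) :
    ‖inner ℂ e h‖ ≤ ‖ℓ h‖ + τ * ‖h‖ := by
  have h1 : inner ℂ e h = ℓ h - (ℓ - innerSL ℂ e) h := by simp
  rw [h1]
  refine (norm_sub_le _ _).trans ?_
  gcongr
  exact (ℓ - innerSL ℂ e).le_of_opNorm_le hℓ h

theorem norm_quadratic_sub_le (B : V →L[ℂ] V →L[ℂ] ℂ) (h k : V) :
    ‖B h h - B k k‖ ≤ ‖B‖ * ‖h - k‖ * (‖h‖ + ‖k‖) := by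
  have h1 : B h h - B k k = B (h - k) h + B k (h - k) := by simp
  rw [h1]
  refine (norm_add_le _ _).trans ?_
  have h2 := B.le_opNorm₂ (h - k) h
  have h3 := B.le_opNorm₂ k (h - k)
  nlinarith

/-- The local defining inequality, rewritten in terms of the coordinates `ℓ h` and `orthPart e h`.
-/
theorem local_defining_coords (he : ‖e‖ = 1) {τ κ η : ℝ} {h : V} (hτ : 0 ≤ τ) (hτ2 : τ ≤ 1 / 2)
    (hℓ : ‖ℓ - innerSL ℂ e‖ ≤ τ) (hh : ‖h‖ ≤ η) (hη : η ≤ 1)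
    (hsmall : 3 * ‖B‖ * η + 2 * (3 * ‖B‖ + 1) * τ ≤ κ)
    (hloc : ‖h‖ ^ 2 + (B h h).re - τ * ‖h‖ ^ 2 ≤ (ℓ h).re) :
    ‖orthPart e h‖ ^ 2 + (B (orthPart e h) (orthPart e h)).re -
      κ * (‖ℓ h‖ + ‖orthPart e h‖ ^ 2) ≤ (ℓ h).re := by
  have hsq := norm_sq_eq_orthPart he h
  have ha := norm_inner_le_of_functional_close hℓ h
  have hah : ‖inner ℂ e h‖ ≤ ‖h‖ := by
    have := norm_inner_le_norm (𝕜 := ℂ) e h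
    rwa [he, one_mul] at this
  have hQ := norm_quadratic_sub_le B h (orthPart e h)
  have hd : h - orthPart e h = inner ℂ e h • e := by simp [orthPart]
  rw [hd, norm_smul, he, mul_one] at hQ
  have hre := (abs_le.1 ((Complex.abs_re_le_norm _).trans hQ)).1
  rw [Complex.sub_re] at hre
  set a := ‖inner ℂ e h‖
  set z := ‖orthPart e h‖
  set w := ‖ℓ h‖
  have hC := norm_nonneg B
  set C := ‖B‖
  have ha0 : 0 ≤ a := norm_nonneg _
  have hz0 : 0 ≤ z := norm_nonneg _
  have hw0 : 0 ≤ w := norm_nonneg _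
  have hh0 : 0 ≤ ‖h‖ := norm_nonneg _
  have hzh : z ≤ ‖h‖ := by nlinarith
  have h1 : C * a * (‖h‖ + z) ≤ 2 * C * (w * ‖h‖ + τ * ‖h‖ ^ 2) := by
    calc C * a * (‖h‖ + z) ≤ C * (w + τ * ‖h‖) * (‖h‖ + ‖h‖) := by gcongr
      _ = _ := by ring
  have h2 : ‖h‖ ^ 2 ≤ 2 * z ^ 2 + 2 * w := by
    have : a ^ 2 ≤ (w + τ * ‖h‖) * ‖h‖ := by
      rw [sq]; gcongr
    nlinarith [mul_nonneg hw0 (sub_nonneg.2 (hh.trans hη)),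
      mul_nonneg (sub_nonneg.2 hτ2) (sq_nonneg ‖h‖)]
  have h3 : w * ‖h‖ ≤ η * w := by nlinarith
  have h4 : τ * ‖h‖ ^ 2 ≤ τ * (2 * z ^ 2 + 2 * w) := by gcongr
  have h5 : 2 * C * (w * ‖h‖ + τ * ‖h‖ ^ 2) ≤ 2 * C * (η * w + τ * (2 * z ^ 2 + 2 * w)) := by
    gcongr
  have hη0 : 0 ≤ η := hh0.trans hh
  have h6 := mul_le_mul_of_nonneg_right hsmall (add_nonneg hw0 (sq_nonneg z))
  have h7 : 0 ≤ 3 * C * η * z ^ 2 := by positivity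
  have h8 : 0 ≤ C * η * w := by positivity
  have h9 : 0 ≤ C * τ * (2 * z ^ 2 + 2 * w) := by positivity
  nlinarith [sq_nonneg a]

theorem exists_cutoff_norm_siegelMap_lt (he : ‖e‖ = 1) (B : V →L[ℂ] V →L[ℂ] ℂ) {c ε : ℝ} (D : ℝ)
    (hc : 0 < c) (hc1 : c ≤ 1) (hε : 0 < ε) :
    ∃ τ > 0, ∀ η > 0, ∃ χ : ℂ → ℂ, ContinuousAt χ 0 ∧ χ 0 = 1 ∧ (∀ w, χ w ≠ 0) ∧
      (∀ w : ℂ, 0 ≤ w.re → DifferentiableAt ℂ χ w) ∧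
      ∃ δ₀ > 0, ∀ (ℓ : V →L[ℂ] ℂ) (δ : ℝ) (h : V), ‖ℓ - innerSL ℂ e‖ ≤ τ → 0 < δ → δ ≤ δ₀ →
        c * ‖h‖ ^ 2 ≤ (ℓ h).re → ‖h‖ ≤ D →
        (‖h‖ < η → ‖h‖ ^ 2 + (B h h).re - τ * ‖h‖ ^ 2 ≤ (ℓ h).re) →
        (δ : ℂ) + shearedCoord e B χ ℓ h ≠ 0 ∧ ‖siegelMap e B χ ℓ δ h‖ < 1 + ε := by
  obtain ⟨C, hC⟩ : ∃ C, C = ‖B‖ := ⟨_, rfl⟩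
  have hC0 : 0 ≤ C := hC ▸ norm_nonneg B
  obtain ⟨κ, hκ, hκ1, hκ2, hκ3⟩ : ∃ κ : ℝ, 0 < κ ∧ κ ≤ 1 / 4 ∧ κ ≤ c / (4 * (C + 1)) ∧
      κ ≤ ε * (c / (6 * (C + 1))) ^ 2 / 2 :=
    ⟨min (1 / 4) (min (c / (4 * (C + 1))) (ε * (c / (6 * (C + 1))) ^ 2 / 2)), by positivity,
      min_le_left _ _, (min_le_right _ _).trans (min_le_left _ _),
      (min_le_right _ _).trans (min_le_right _ _)⟩
  have hτ0 : 0 < κ / (4 * (3 * C + 1)) := by positivity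
  refine ⟨κ / (4 * (3 * C + 1)), hτ0, ?_⟩
  set τ := κ / (4 * (3 * C + 1)) with hτ
  have hτC : 4 * (3 * C + 1) * τ = κ := by rw [hτ]; field_simp
  intro η hη
  obtain ⟨η₁, hη₁, hη₁1, hη₁η, hη₁κ⟩ : ∃ η₁ : ℝ, 0 < η₁ ∧ η₁ ≤ 1 ∧ η₁ ≤ η ∧
      3 * C * η₁ ≤ κ / 2 := by
    refine ⟨min 1 (min η (κ / (6 * (C + 1)))), by positivity, min_le_left _ _,
      (min_le_right _ _).trans (min_le_left _ _), ?_⟩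
    have h1 : min 1 (min η (κ / (6 * (C + 1)))) ≤ κ / (6 * (C + 1)) :=
      (min_le_right _ _).trans (min_le_right _ _)
    rw [le_div_iff₀ (by positivity)] at h1
    have h2 : 0 < min 1 (min η (κ / (6 * (C + 1)))) := by positivity
    linarith
  have hs0 : 0 < κ / (C + 1) := by positivity
  obtain ⟨χ, hχc, hχ0, hχne, hχ⟩ := exists_holomorphic_cutoff (s := κ / (C + 1))
    (κ := c * η₁ ^ 2) (θ := c / (2 * (C + 1))) hs0 (by positivity) (by positivity)
  refine ⟨χ, hχc, hχ0, hχne, fun w hw => (hχ w hw).1,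
    ε * (c * η₁ ^ 2 / 2) ^ 2 / (4 * (D ^ 2 + 1)), by positivity, ?_⟩
  intro ℓ δ h hℓ hδ hδ₀ hch hD hloc
  have hre0 : 0 ≤ (ℓ h).re := le_trans (by positivity) hch
  obtain ⟨-, hx1, hx2, hx3⟩ := hχ _ hre0
  have hsq := norm_sq_eq_orthPart he h
  have hz0 := norm_nonneg (orthPart e h)
  have hzh2 : ‖orthPart e h‖ ^ 2 ≤ ‖h‖ ^ 2 := by linarith [sq_nonneg ‖inner ℂ e h‖]
  have hQ : ‖B (orthPart e h) (orthPart e h)‖ ≤ C * ‖orthPart e h‖ ^ 2 := by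
    have := B.le_opNorm₂ (orthPart e h) (orthPart e h)
    rw [← hC] at this; linarith
  have ht1 : ‖χ (ℓ h)‖ ^ 2 ≤ 1 := pow_le_one₀ (norm_nonneg _) hx1
  have key : 0 < ‖(δ : ℂ) + shearedCoord e B χ ℓ h‖ ∧
      4 * δ * (‖χ (ℓ h)‖ ^ 2 * ‖orthPart e h‖ ^ 2 - (shearedCoord e B χ ℓ h).re) ≤
        ε * ‖(δ : ℂ) + shearedCoord e B χ ℓ h‖ ^ 2 := by
    by_cases hη' : ‖h‖ < η₁
    · have hτ2 : τ ≤ 1 / 2 := by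
        have := mul_nonneg hC0 hτ0.le
        linarith
      have h1 := local_defining_coords (κ := κ) he hτ0.le hτ2 hℓ hη'.le hη₁1
        (by rw [← hC]; linarith) (hloc (hη'.trans_le hη₁η))
      have hsC : κ / (C + 1) * C ≤ κ := by
        rw [div_mul_eq_mul_div, div_le_iff₀ (by positivity)]; nlinarith
      have hκ2' : κ * (C + 1) ≤ c / 4 := by
        rw [le_div_iff₀ (by positivity)] at hκ2; linarith
      refine siegel_estimate (s := κ / (C + 1)) (κ := κ) (c := c) (C := C) (by positivity) ht1 hx2
        (by rw [norm_pow]; exact ht1) (by positivity) hc hc1 hC0 ?_ hQ hκ1 hκ.le ?_ h1 hδ hε.le ?_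
      · exact (mul_le_mul_of_nonneg_left hzh2 hc.le).trans hch
      · linarith [hC0, mul_nonneg hκ.le hC0]
      · linarith
    · have hη'' : η₁ ≤ ‖h‖ := not_lt.1 hη'
      have hreη : c * η₁ ^ 2 ≤ (ℓ h).re := le_trans (by gcongr) hch
      have ht := hx3 hreη
      have hxq : ‖χ (ℓ h) ^ 2 * B (orthPart e h) (orthPart e h)‖ ≤ (ℓ h).re / 2 := by
        rw [norm_mul, norm_pow]
        calc _ ≤ c / (2 * (C + 1)) * (C * ‖orthPart e h‖ ^ 2) := by gcongr
          _ ≤ c / (2 * (C + 1)) * ((C + 1) * ‖h‖ ^ 2) := by gcongr; linarith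
          _ = c * ‖h‖ ^ 2 / 2 := by field_simp
          _ ≤ _ := by linarith
      have hD2 : ‖h‖ ^ 2 ≤ D ^ 2 := by gcongr
      rw [le_div_iff₀ (by positivity)] at hδ₀
      exact siegel_estimate_far (D := D ^ 2) (μ := c * η₁ ^ 2 / 2) ht1 (by positivity)
        (hzh2.trans hD2) hxq (by positivity) (by linarith) hδ hε.le (by linarith)
  obtain ⟨k1, k2⟩ := key
  have hne := norm_pos_iff.1 k1
  refine ⟨hne, ?_⟩
  have h1 := norm_sq_siegelMap he hδ hne
  have h2 : 4 * δ * (‖χ (ℓ h)‖ ^ 2 * ‖orthPart e h‖ ^ 2 - (shearedCoord e B χ ℓ h).re) /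
      ‖(δ : ℂ) + shearedCoord e B χ ℓ h‖ ^ 2 ≤ ε := by
    rwa [div_le_iff₀ (by positivity)]
  refine lt_of_pow_lt_pow_left₀ 2 (by positivity) ?_
  linarith [sq_nonneg ε]

end SiegelMap

section SiegelMapSurjective

variable {V : Type*} [NormedAddCommGroup V] [InnerProductSpace ℂ V]

/-- Rescaled coordinates of the preimage, under the Cayley transform, of a point of the ball of
radius `1 - ε`. -/
theorem cayley_preimage {e y : V} (he : ‖e‖ = 1) {ε : ℝ} (hε : 0 < ε) (hy : ‖y‖ < 1 - ε) :
    ∃ (u : ℂ) (Z : V), 1 + u ≠ 0 ∧ inner ℂ e Z = 0 ∧ ‖u‖ ≤ 2 / ε ∧ ‖Z‖ ≤ 1 / ε ∧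
      ε / 4 ≤ u.re - ‖Z‖ ^ 2 ∧ ((1 - u) / (1 + u)) • e + (2 / (1 + u)) • Z = y := by
  have hsq := norm_sq_eq_orthPart he y
  have hin := inner_orthPart he y
  set β := inner ℂ e y with hβ
  have hβy : ‖β‖ ≤ ‖y‖ := by
    have := norm_inner_le_norm (𝕜 := ℂ) e y
    rwa [he, one_mul] at this
  have hβε : ε ≤ ‖1 + β‖ := by
    have := norm_sub_norm_le (1 : ℂ) (-β)
    rw [norm_neg, norm_one, sub_neg_eq_add] at this
    linarith
  have hβ2 : ‖1 + β‖ ≤ 2 := by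
    have := norm_add_le (1 : ℂ) β
    rw [norm_one] at this
    linarith
  have hpos : 0 < ‖1 + β‖ := hε.trans_le hβε
  have hne : 1 + β ≠ 0 := norm_pos_iff.1 hpos
  have hu1 : 1 + (1 - β) / (1 + β) = 2 / (1 + β) := by field_simp; ring
  refine ⟨(1 - β) / (1 + β), (1 / (1 + β)) • orthPart e y, ?_, ?_, ?_, ?_, ?_, ?_⟩
  · rw [hu1]; exact div_ne_zero two_ne_zero hne
  · rw [inner_smul_right, hin, mul_zero]
  · rw [norm_div]
    have : ‖1 - β‖ ≤ 2 := by
      have := norm_sub_le (1 : ℂ) β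
      rw [norm_one] at this
      linarith
    gcongr
  · rw [norm_smul, norm_div, norm_one]
    have : ‖orthPart e y‖ ≤ 1 := by nlinarith [norm_nonneg (orthPart e y), norm_nonneg y]
    calc _ ≤ 1 / ε * 1 := by gcongr
      _ = _ := mul_one _
  · have hre : ((1 - β) / (1 + β)).re = (1 - ‖β‖ ^ 2) / ‖1 + β‖ ^ 2 := by
      rw [Complex.div_re, ← Complex.normSq_eq_norm_sq, ← Complex.normSq_eq_norm_sq, ← add_div]
      congr 1
      rw [Complex.normSq_apply]
      simp; ring
    rw [hre, norm_smul, norm_div, norm_one, mul_pow, div_pow, one_pow, div_mul_eq_mul_div,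
      ← sub_div, le_div_iff₀ (by positivity)]
    have h1 : ‖1 + β‖ ^ 2 ≤ 4 := by nlinarith
    nlinarith [norm_nonneg y]
  · rw [hu1]
    have h1 : (1 - (1 - β) / (1 + β)) / (2 / (1 + β)) = β := by field_simp; ring
    have h2 : 2 / (2 / (1 + β)) * (1 / (1 + β)) = 1 := by field_simp
    rw [h1, smul_smul, h2, one_smul, orthPart]
    abel

theorem norm_sq_add_quadratic_le (B : V →L[ℂ] V →L[ℂ] ℂ) {k Z : V} {γ τ N : ℝ} (hτ : 0 ≤ τ)
    (hkZ : ‖k - Z‖ ≤ γ) (hkN : ‖k‖ ≤ N) (hZN : ‖Z‖ ≤ N) :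
    ‖k‖ ^ 2 + (B k k).re + τ * ‖k‖ ^ 2 ≤
      ‖Z‖ ^ 2 + (B Z Z).re + (1 + ‖B‖) * γ * (2 * N) + τ * N ^ 2 := by
  have hγ0 : 0 ≤ γ := (norm_nonneg _).trans hkZ
  have hγ2 : ‖k - Z‖ * (‖k‖ + ‖Z‖) ≤ γ * (2 * N) := by
    calc _ ≤ γ * (N + N) := by gcongr
      _ = _ := by ring
  have h1 : ‖k‖ ^ 2 - ‖Z‖ ^ 2 ≤ γ * (2 * N) := by
    refine le_trans ?_ hγ2
    have := norm_sub_norm_le k Z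
    nlinarith [norm_nonneg k, norm_nonneg Z]
  have h2 : (B k k).re - (B Z Z).re ≤ ‖B‖ * (γ * (2 * N)) := by
    rw [← Complex.sub_re]
    refine (Complex.re_le_norm _).trans ((norm_quadratic_sub_le B k Z).trans ?_)
    rw [mul_assoc]
    gcongr
  have h3 : τ * ‖k‖ ^ 2 ≤ τ * N ^ 2 := by gcongr
  linarith

set_option maxHeartbeats 1000000 in
theorem exists_siegelMap_eq {e : V} (he : ‖e‖ = 1) (B : V →L[ℂ] V →L[ℂ] ℂ) {ε : ℝ} (hε : 0 < ε) :
    ∃ τ > 0, ∀ η > 0, ∀ χ : ℂ → ℂ, ContinuousAt χ 0 → χ 0 = 1 → (∀ w, χ w ≠ 0) →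
      ∃ δ₀ > 0, ∀ (ℓ : V →L[ℂ] ℂ) (δ : ℝ) (y : V), ‖ℓ - innerSL ℂ e‖ ≤ τ → 0 < δ → δ ≤ δ₀ →
        ‖y‖ < 1 - ε → ∃ h, ‖h‖ < η ∧ ‖h‖ ^ 2 + (B h h).re + τ * ‖h‖ ^ 2 < (ℓ h).re ∧
          siegelMap e B χ ℓ δ h = y := by
  obtain ⟨C, hC⟩ : ∃ C, C = ‖B‖ := ⟨_, rfl⟩
  have hC0 : 0 ≤ C := hC ▸ norm_nonneg B
  obtain ⟨N, hN⟩ : ∃ N, N = 1 / ε + 1 := ⟨_, rfl⟩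
  have hN1 : 0 < N := by rw [hN]; positivity
  obtain ⟨W, hW⟩ : ∃ W, W = 2 / ε + C * (1 / ε) ^ 2 := ⟨_, rfl⟩
  have hW0 : 0 < W := by rw [hW]; positivity
  obtain ⟨γ, hγ0, hγ1, hγ⟩ : ∃ γ : ℝ, 0 < γ ∧ γ ≤ 1 ∧ (1 + C) * γ * (2 * N) ≤ ε / 16 := by
    refine ⟨min 1 (ε / (32 * (1 + C) * N)), by positivity, min_le_left _ _, ?_⟩
    have := min_le_right 1 (ε / (32 * (1 + C) * N))
    rw [le_div_iff₀ (by positivity)] at this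
    linarith
  obtain ⟨τ, hτ0, hτ1, hτ2, hτ3⟩ : ∃ τ : ℝ, 0 < τ ∧ τ ≤ 1 / 2 ∧ τ ≤ ε * γ / 16 ∧
      τ * N ^ 2 ≤ ε / 16 := by
    refine ⟨min (1 / 2) (min (ε * γ / 16) (ε / (16 * N ^ 2))), by positivity, min_le_left _ _,
      (min_le_right _ _).trans (min_le_left _ _), ?_⟩
    have := (min_le_right (1 / 2) (min (ε * γ / 16) (ε / (16 * N ^ 2)))).trans (min_le_right _ _)
    rw [le_div_iff₀ (by positivity)] at this
    linarith
  refine ⟨τ, hτ0, ?_⟩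
  intro η hη χ hχc hχ0 hχne
  obtain ⟨r, hr, hχr⟩ : ∃ r > 0, ∀ w : ℂ, ‖w‖ < r → ‖(χ w)⁻¹ - 1‖ < γ * ε / 2 := by
    have h1 : ContinuousAt (fun w => (χ w)⁻¹) 0 := hχc.inv₀ (hχne 0)
    obtain ⟨r, hr, h⟩ := Metric.continuousAt_iff.1 h1 (γ * ε / 2) (by positivity)
    refine ⟨r, hr, fun w hw => ?_⟩
    have := h (x := w) (by simpa using hw)
    simpa [hχ0, dist_eq_norm] using this
  obtain ⟨a, ha0, ha1, ha2, ha3, ha4⟩ : ∃ a : ℝ, 0 < a ∧ a ≤ 1 ∧ a * W ≤ γ / 8 ∧ a * N < η ∧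
      a * W < r := by
    obtain ⟨a, ha⟩ : ∃ a, a = min 1 (min (γ / (8 * W)) (min (η / (2 * N)) (r / (2 * W)))) :=
      ⟨_, rfl⟩
    have ha0 : 0 < a := by rw [ha]; positivity
    have h1 : a ≤ γ / (8 * W) := ha ▸ (min_le_right _ _).trans (min_le_left _ _)
    have h2 : a ≤ η / (2 * N) :=
      ha ▸ (min_le_right _ _).trans ((min_le_right _ _).trans (min_le_left _ _))
    have h3 : a ≤ r / (2 * W) :=
      ha ▸ (min_le_right _ _).trans ((min_le_right _ _).trans (min_le_right _ _))
    rw [le_div_iff₀ (by positivity)] at h1 h2 h3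
    exact ⟨a, ha0, ha ▸ min_le_left _ _, by linarith, by linarith, by linarith⟩
  refine ⟨a ^ 2, by positivity, ?_⟩
  intro ℓ δ y hℓ hδ hδa hy
  have hε1 : ε < 1 := by linarith [norm_nonneg y]
  obtain ⟨u, Z, hu1, hZe, hu, hZ, huZ, hyeq⟩ := cayley_preimage he hε hy
  have hs0 : 0 < √δ := Real.sqrt_pos.2 hδ
  have hsa : √δ ≤ a := by rw [Real.sqrt_le_left ha0.le]; exact hδa
  have hss : √δ * √δ = δ := Real.mul_self_sqrt hδ.le
  have hssC : (√δ : ℂ) * √δ = δ := by exact_mod_cast hss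
  have hδs : δ ≤ √δ := by nlinarith
  have hsn : ‖(√δ : ℂ)‖ = √δ := by
    rw [Complex.norm_real, Real.norm_eq_abs, abs_of_pos hs0]
  set w' : ℂ := u + B Z Z with hw'
  have hw'W : ‖w'‖ ≤ W := by
    refine (norm_add_le _ _).trans ?_
    have h1 := B.le_opNorm₂ Z Z
    rw [← hC] at h1
    have h2 : C * ‖Z‖ * ‖Z‖ ≤ C * (1 / ε) ^ 2 := by
      rw [mul_assoc, ← sq]; gcongr
    rw [hW]; linarith
  have hv := hχr (δ * w') (by
    rw [norm_mul, Complex.norm_real, Real.norm_eq_abs, abs_of_pos hδ]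
    calc δ * ‖w'‖ ≤ a * W := by gcongr; linarith
      _ < r := ha4)
  set v := (χ (δ * w'))⁻¹ with hvdef
  have hvn : ‖v‖ ≤ 2 := by
    have h1 : v = 1 + (v - 1) := by ring
    have h2 := norm_add_le (1 : ℂ) (v - 1)
    rw [← h1, norm_one] at h2
    nlinarith
  have hℓe : 1 / 2 ≤ ‖ℓ e‖ := by
    have h1 := norm_inner_le_of_functional_close hℓ e
    rw [inner_self_eq_norm_sq_to_K, he] at h1
    simp at h1
    linarith
  have hℓe0 : ℓ e ≠ 0 := norm_pos_iff.1 (by linarith)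
  have hℓv : ‖ℓ (v • Z)‖ ≤ γ / 8 := by
    have h1 : ℓ (v • Z) = (ℓ - innerSL ℂ e) (v • Z) := by simp [hZe]
    rw [h1]
    refine ((ℓ - innerSL ℂ e).le_of_opNorm_le hℓ _).trans ?_
    rw [norm_smul]
    calc τ * (‖v‖ * ‖Z‖) ≤ (ε * γ / 16) * (2 * (1 / ε)) := by gcongr
      _ = γ / 8 := by field_simp; norm_num
  set α : ℂ := (√δ * w' - ℓ (v • Z)) / ℓ e with hα
  have hαn : ‖α‖ ≤ γ / 2 := by
    rw [hα, norm_div, div_le_iff₀ (by linarith)]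
    refine (norm_sub_le _ _).trans ?_
    have h1 : ‖(√δ : ℂ) * w'‖ ≤ γ / 8 := by
      rw [norm_mul, hsn]
      calc √δ * ‖w'‖ ≤ a * W := by gcongr
        _ ≤ _ := ha2
    nlinarith
  set k : V := v • Z + α • e with hk
  have hkZ : ‖k - Z‖ ≤ γ := by
    have h1 : k - Z = (v - 1) • Z + α • e := by rw [hk, sub_smul, one_smul]; abel
    rw [h1]
    refine (norm_add_le _ _).trans ?_
    rw [norm_smul, norm_smul, he, mul_one]
    have : ‖v - 1‖ * ‖Z‖ ≤ γ * ε / 2 * (1 / ε) := by gcongr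
    have h2 : γ * ε / 2 * (1 / ε) = γ / 2 := by field_simp
    linarith
  have hkN : ‖k‖ ≤ N := by
    have h1 : k = Z + (k - Z) := by abel
    have h2 := norm_add_le Z (k - Z)
    rw [← h1] at h2
    rw [hN]; linarith
  have hZN : ‖Z‖ ≤ N := by rw [hN]; linarith
  have hmain : ‖k‖ ^ 2 + (B k k).re + τ * ‖k‖ ^ 2 < w'.re := by
    have h1 := norm_sq_add_quadratic_le B hτ0.le hkZ hkN hZN
    rw [← hC] at h1
    rw [hw', Complex.add_re]
    linarith
  have hz : inner ℂ e ((√δ * v : ℂ) • Z) = 0 := by rw [inner_smul_right, hZe, mul_zero]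
  obtain ⟨hc1, hc2⟩ := siegelMap_coords (ℓ := ℓ) (w := δ * w') he hℓe0 hz
  have hhk : (√δ * v : ℂ) • Z + (((δ : ℂ) * w' - ℓ ((√δ * v : ℂ) • Z)) / ℓ e) • e
      = (√δ : ℂ) • k := by
    rw [hk, smul_add, smul_smul, smul_smul, hα]
    congr 2
    rw [← hssC, mul_smul, map_smul, smul_eq_mul]
    ring
  rw [hhk] at hc1 hc2
  refine ⟨(√δ : ℂ) • k, ?_, ?_, ?_⟩
  · rw [norm_smul, hsn]
    calc √δ * ‖k‖ ≤ a * N := by gcongr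
      _ < η := ha3
  · rw [hc1, norm_smul, hsn, mul_pow, sq √δ, hss]
    have h1 : B ((√δ : ℂ) • k) ((√δ : ℂ) • k) = δ * B k k := by
      simp only [map_smul, smul_apply, smul_eq_mul]
      rw [← hssC]; ring
    rw [h1, Complex.re_ofReal_mul, Complex.re_ofReal_mul]
    nlinarith
  · have hδC : (δ : ℂ) ≠ 0 := by exact_mod_cast hδ.ne'
    have hvχ : χ (δ * w') * v = 1 := by rw [hvdef]; exact mul_inv_cancel₀ (hχne _)
    have hsc : shearedCoord e B χ ℓ ((√δ : ℂ) • k) = δ * u := by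
      rw [shearedCoord, hc1, hc2]
      simp only [map_smul, smul_apply, smul_eq_mul]
      have : χ (δ * w') ^ 2 * (√δ * v * (√δ * v * B Z Z)) =
        (χ (δ * w') * v) ^ 2 * (√δ * √δ) * B Z Z := by ring
      rw [this, hvχ, hssC, hw']; ring
    rw [siegelMap, hsc, hc1, hc2, smul_smul, ← hyeq]
    congr 2
    · field_simp
    · have h1 : (δ : ℂ) + δ * u = δ * (1 + u) := by ring
      rw [h1]
      calc _ = 2 * (√δ * √δ) / (δ * (1 + u)) * (χ (δ * w') * v) := by ring
        _ = 2 / (1 + u) := by rw [hvχ, hssC]; field_simp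

end SiegelMapSurjective

theorem norm_siegelMap_normal_le {V : Type*} [NormedAddCommGroup V] [InnerProductSpace ℂ V] {e : V}
    (he : ‖e‖ = 1) (B : V →L[ℂ] V →L[ℂ] ℂ) (χ : ℂ → ℂ) {ℓ : V →L[ℂ] ℂ} {δ τ : ℝ} (hδ : 0 < δ)
    (hτ : τ ≤ 1) (hℓ : ‖ℓ - innerSL ℂ e‖ ≤ τ) : ‖siegelMap e B χ ℓ δ ((δ : ℂ) • e)‖ ≤ τ := by
  have hδC : (δ : ℂ) ≠ 0 := by exact_mod_cast hδ.ne'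
  have hee : inner ℂ e e = 1 := by simp [inner_self_eq_norm_sq_to_K, he]
  have ho : orthPart e ((δ : ℂ) • e) = 0 := by rw [orthPart, inner_smul_right, hee, mul_one, sub_self]
  have hsc : shearedCoord e B χ ℓ ((δ : ℂ) • e) = δ * ℓ e := by
    rw [shearedCoord, ho, map_smul, map_zero, mul_zero, sub_zero, smul_eq_mul]
  have h1 : ‖1 - ℓ e‖ ≤ τ := by
    have h2 := (ℓ - innerSL ℂ e).le_of_opNorm_le hℓ e
    rw [he, mul_one, sub_apply, innerSL_apply_apply, hee, norm_sub_rev] at h2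
    exact h2
  have h2 : 1 ≤ ‖1 + ℓ e‖ := by
    have h3 := norm_sub_norm_le (2 : ℂ) (1 - ℓ e)
    have h4 : (2 : ℂ) - (1 - ℓ e) = 1 + ℓ e := by ring
    rw [h4] at h3
    norm_num at h3
    linarith
  have h3 : ((δ : ℂ) - δ * ℓ e) / (δ + δ * ℓ e) = (1 - ℓ e) / (1 + ℓ e) := by
    have : 1 + ℓ e ≠ 0 := norm_pos_iff.1 (by linarith)
    have h5 : (δ : ℂ) + δ * ℓ e = δ * (1 + ℓ e) := by ring
    rw [h5]
    field_simp
  rw [siegelMap, ho, hsc, smul_zero, add_zero, norm_smul, he, mul_one, h3, norm_div]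
  exact (div_le_self (norm_nonneg _) h2).trans h1

/-- A set which near `0` is squeezed between two nearby quadratic models, and which lies globally on
the convex side of a paraboloid, is mapped almost onto the unit ball, with the point at depth `δ`
going almost to the center. -/
theorem exists_map_near_ball {V : Type*} [NormedAddCommGroup V] [InnerProductSpace ℂ V] {e : V}
    (he : ‖e‖ = 1) (B : V →L[ℂ] V →L[ℂ] ℂ) {c ε : ℝ} (D : ℝ) (hc : 0 < c) (hε : 0 < ε) :
    ∃ τ > 0, ∀ η > 0, ∃ δ₀ > 0, ∀ (U : Set V) (ℓ : V →L[ℂ] ℂ) (δ : ℝ), ‖ℓ - innerSL ℂ e‖ ≤ τ →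
      0 < δ → δ ≤ δ₀ → (∀ h ∈ U, c * ‖h‖ ^ 2 ≤ (ℓ h).re ∧ ‖h‖ ≤ D) →
      (∀ h ∈ U, ‖h‖ < η → ‖h‖ ^ 2 + (B h h).re - τ * ‖h‖ ^ 2 ≤ (ℓ h).re) →
      (∀ h, ‖h‖ < η → ‖h‖ ^ 2 + (B h h).re + τ * ‖h‖ ^ 2 < (ℓ h).re → h ∈ U) →
      ∃ F : V → V, DifferentiableOn ℂ F U ∧ InjOn F U ∧ F '' U ⊆ ball 0 (1 + ε) ∧
        ball 0 (1 - ε) ⊆ F '' U ∧ ‖F ((δ : ℂ) • e)‖ ≤ ε := by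
  obtain ⟨τ₁, hτ₁, H₁⟩ := exists_cutoff_norm_siegelMap_lt he B (c := min c 1) D
    (lt_min hc one_pos) (min_le_right _ _) hε
  obtain ⟨τ₂, hτ₂, H₂⟩ := exists_siegelMap_eq he B hε
  obtain ⟨τ, hτ0, hτ1, hτ2, hτε, hτh⟩ : ∃ τ : ℝ, 0 < τ ∧ τ ≤ τ₁ ∧ τ ≤ τ₂ ∧ τ ≤ ε ∧ τ ≤ 1 / 2 := by
    refine ⟨min (min τ₁ τ₂) (min ε (1 / 2)), by positivity, ?_, ?_, ?_, ?_⟩ <;> simp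
  refine ⟨τ, hτ0, fun η hη => ?_⟩
  obtain ⟨χ, hχc, hχ0, hχne, hχd, δ₁, hδ₁, H₁⟩ := H₁ η hη
  obtain ⟨δ₂, hδ₂, H₂⟩ := H₂ η hη χ hχc hχ0 hχne
  refine ⟨min δ₁ δ₂, lt_min hδ₁ hδ₂, fun U ℓ δ hℓ hδ hδ₀ hglob hin hout => ?_⟩
  have hU : ∀ h ∈ U, (δ : ℂ) + shearedCoord e B χ ℓ h ≠ 0 ∧
      ‖siegelMap e B χ ℓ δ h‖ < 1 + ε := by
    intro h hh
    obtain ⟨h1, h2⟩ := hglob h hh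
    refine H₁ ℓ δ h (hℓ.trans hτ1) hδ (hδ₀.trans (min_le_left _ _)) ?_ h2 fun h3 => ?_
    · exact le_trans (by gcongr; exact min_le_left _ _) h1
    · exact le_trans (by gcongr) (hin h hh h3)
  have hℓe : ℓ e ≠ 0 := by
    intro h0
    have h1 := norm_inner_le_of_functional_close hℓ e
    rw [h0, inner_self_eq_norm_sq_to_K, he] at h1
    norm_num at h1
    linarith
  refine ⟨siegelMap e B χ ℓ δ, fun h hh => ?_, injOn_siegelMap he hδ hχne hℓe fun h hh => (hU h hh).1,
    ?_, ?_, (norm_siegelMap_normal_le he B χ hδ (by linarith) hℓ).trans hτε⟩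
  · refine (differentiableAt_siegelMap (hχd _ ?_) (hU h hh).1).differentiableWithinAt
    exact le_trans (by positivity) (hglob h hh).1
  · rintro _ ⟨h, hh, rfl⟩
    rw [mem_ball_zero_iff]
    exact (hU h hh).2
  · intro y hy
    rw [mem_ball_zero_iff] at hy
    obtain ⟨h, h1, h2, h3⟩ := H₂ ℓ δ y (hℓ.trans hτ2) hδ (hδ₀.trans (min_le_right _ _)) hy
    refine ⟨h, hout h h1 (lt_of_le_of_lt ?_ h2), h3⟩
    gcongr

theorem le_squeezingFun {n : ℕ} {Ω : Set (EuclideanSpace ℂ (Fin n))}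
    {q e : EuclideanSpace ℂ (Fin n)} (he : ‖e‖ = 1) {ε : ℝ} (hε : 0 < ε)
    (hε1 : ε < 1 / 2) {F : EuclideanSpace ℂ (Fin n) → EuclideanSpace ℂ (Fin n)}
    (hF : DifferentiableOn ℂ F Ω) (hinj : InjOn F Ω) (hsub : F '' Ω ⊆ ball 0 (1 + ε))
    (hsup : ball 0 (1 - ε) ⊆ F '' Ω) (hFq : ‖F q‖ ≤ ε) :
    (1 - 2 * ε) / (1 + 2 * ε) ≤ squeezingFun n Ω q := by
  have hb : BddAbove { r : ℝ | 0 < r ∧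
      ∃ f : EuclideanSpace ℂ (Fin n) → EuclideanSpace ℂ (Fin n),
      DifferentiableOn ℂ f Ω ∧ InjOn f Ω ∧ f '' Ω ⊆ ball 0 1 ∧ f q = 0 ∧ ball 0 r ⊆ f '' Ω } := by
    refine ⟨1, ?_⟩
    rintro r ⟨-, f, -, -, h1, -, h2⟩
    by_contra h
    have h3 : e ∈ ball (0 : EuclideanSpace ℂ (Fin n)) r := by
      rw [mem_ball_zero_iff, he]; exact not_le.1 h
    have h4 := h1 (h2 h3)
    rw [mem_ball_zero_iff, he] at h4
    exact lt_irrefl _ h4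
  have hp : 0 < 1 + 2 * ε := by positivity
  have hpC : ((1 + 2 * ε : ℝ) : ℂ) ≠ 0 := by exact_mod_cast hp.ne'
  have hn : ∀ x : EuclideanSpace ℂ (Fin n),
      ‖((1 + 2 * ε : ℝ) : ℂ)⁻¹ • x‖ = ‖x‖ / (1 + 2 * ε) := by
    intro x
    rw [norm_smul, norm_inv, Complex.norm_real, Real.norm_eq_abs, abs_of_pos hp]
    field_simp
  refine le_csSup hb ⟨div_pos (by linarith) hp,
    fun x => ((1 + 2 * ε : ℝ) : ℂ)⁻¹ • (F x - F q), ?_, ?_, ?_, ?_, ?_⟩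
  · fun_prop
  · intro x hx y hy hxy
    have h1 := smul_right_injective _ (inv_ne_zero hpC) hxy
    exact hinj hx hy (sub_left_inj.1 h1)
  · rintro _ ⟨x, hx, rfl⟩
    have h1 := hsub ⟨x, hx, rfl⟩
    rw [mem_ball_zero_iff] at h1 ⊢
    rw [hn, div_lt_one hp]
    have := norm_sub_le (F x) (F q)
    linarith
  · simp
  · intro y hy
    rw [mem_ball_zero_iff, lt_div_iff₀ hp] at hy
    have h1 : ((1 + 2 * ε : ℝ) : ℂ) • y + F q ∈ ball (0 : EuclideanSpace ℂ (Fin n)) (1 - ε) := by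
      rw [mem_ball_zero_iff]
      refine (norm_add_le _ _).trans_lt ?_
      rw [norm_smul, Complex.norm_real, Real.norm_eq_abs, abs_of_pos hp]
      linarith
    obtain ⟨x, hx, hxy⟩ := hsup h1
    refine ⟨x, hx, ?_⟩
    change ((1 + 2 * ε : ℝ) : ℂ)⁻¹ • (F x - F q) = y
    rw [hxy, add_sub_cancel_right, smul_smul, inv_mul_cancel₀ hpC, one_smul]

/-- Second-order Taylor expansion of a `C²` function, uniform in the base point. -/
theorem exists_ball_norm_taylor_two_le {E : Type*} [NormedAddCommGroup E] [NormedSpace ℝ E]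
    {ρ : E → ℝ} {p : E} (hρ : ContDiffAt ℝ 2 ρ p) {ε : ℝ} (hε : 0 < ε) :
    ∃ r > 0, ∀ x ∈ ball p r, ∀ y ∈ ball p r,
      |ρ x - ρ y - fderiv ℝ ρ y (x - y) -
        fderiv ℝ (fderiv ℝ ρ) p (x - y) (x - y) / 2| ≤ ε * ‖x - y‖ ^ 2 := by
  have hd : ∀ᶠ x in nhds p, DifferentiableAt ℝ ρ x :=
    (hρ.eventually (by simp)).mono fun x hx => hx.differentiableAt (by norm_num)
  have hs : HasStrictFDerivAt (fderiv ℝ ρ) (fderiv ℝ (fderiv ℝ ρ) p) p :=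
    (hρ.fderiv_right (m := 1) (by norm_num)).hasStrictFDerivAt (by norm_num)
  obtain ⟨r₁, hr₁, hd⟩ := Metric.eventually_nhds_iff_ball.1 hd
  have hl := hs.isLittleO.def hε
  rw [nhds_prod_eq, Filter.eventually_iff, (nhds_basis_ball.prod_self).mem_iff] at hl
  obtain ⟨r₂, hr₂, hl⟩ := hl
  set D := fderiv ℝ (fderiv ℝ ρ) p
  refine ⟨min r₁ r₂, lt_min hr₁ hr₂, fun x hx y hy => ?_⟩
  have hseg : ∀ t ∈ Icc (0 : ℝ) 1, y + t • (x - y) ∈ ball p (min r₁ r₂) := fun t ht =>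
    (convex_ball p _).add_smul_sub_mem hy hx ht
  have hφ : ∀ t ∈ Icc (0 : ℝ) 1, HasDerivWithinAt
      (fun t : ℝ => ρ (y + t • (x - y)) - t * fderiv ℝ ρ y (x - y) -
        t ^ 2 * (D (x - y) (x - y) / 2))
      ((fderiv ℝ ρ (y + t • (x - y)) - fderiv ℝ ρ y - D (t • (x - y))) (x - y))
      (Icc 0 1) t := by
    intro t ht
    have h1 : HasDerivAt (fun t : ℝ => y + t • (x - y)) (x - y) t := by
      simpa using ((hasDerivAt_id t).smul_const (x - y)).const_add y
    have h2 := (hd _ (ball_subset_ball (min_le_left _ _) (hseg t ht))).hasFDerivAt.comp_hasDerivAt t h1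
    have h3 := (h2.sub ((hasDerivAt_id t).mul_const (fderiv ℝ ρ y (x - y)))).sub
      ((hasDerivAt_pow 2 t).mul_const (D (x - y) (x - y) / 2))
    refine (h3.congr_deriv ?_).hasDerivWithinAt
    simp
    ring
  have hb : ∀ t ∈ Ico (0 : ℝ) 1,
      ‖(fderiv ℝ ρ (y + t • (x - y)) - fderiv ℝ ρ y - D (t • (x - y))) (x - y)‖ ≤
        ε * ‖x - y‖ ^ 2 := by
    intro t ht
    have h1 := @hl (y + t • (x - y), y) ⟨ball_subset_ball (min_le_right _ _)
      (hseg t ⟨ht.1, ht.2.le⟩), ball_subset_ball (min_le_right _ _) hy⟩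
    simp only [Set.mem_ofPred_eq, add_sub_cancel_left] at h1
    have h2 : ‖t • (x - y)‖ ≤ ‖x - y‖ := by
      rw [norm_smul, Real.norm_of_nonneg ht.1]
      exact mul_le_of_le_one_left (norm_nonneg _) ht.2.le
    calc _ ≤ ‖fderiv ℝ ρ (y + t • (x - y)) - fderiv ℝ ρ y - D (t • (x - y))‖ * ‖x - y‖ :=
          ContinuousLinearMap.le_opNorm _ _
      _ ≤ (ε * ‖x - y‖) * ‖x - y‖ := by
          gcongr
          exact h1.trans (by gcongr)
      _ = _ := by ring
  have := norm_image_sub_le_of_norm_deriv_le_segment_01' hφ hb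
  rw [Real.norm_eq_abs] at this
  convert this using 2
  simp
  ring

section SphericallyExtreme

variable {F : Type*} [NormedAddCommGroup F] [InnerProductSpace ℝ F]

theorem inner_pos_of_supported {ν : F} {L : F →L[ℝ] ℝ} {D : F →L[ℝ] F →L[ℝ] ℝ}
    (H : ∀ ε > 0, ∃ r > 0, ∀ h : F, ‖h‖ < r →
      L h + D h h / 2 + ε * ‖h‖ ^ 2 < 0 → ‖h‖ ^ 2 ≤ 2 * inner ℝ ν h)
    {v : F} (hv : L v < 0) : 0 < inner ℝ ν v := by
  obtain ⟨r, hr, H⟩ := H 1 one_pos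
  have h1 : ∀ᶠ t : ℝ in nhds 0, ‖t • v‖ < r :=
    (show Continuous fun t : ℝ => ‖t • v‖ by fun_prop).continuousAt.eventually_lt_const
      (by simpa using hr)
  have h2 : ∀ᶠ t : ℝ in nhds 0, L v + t * (D v v / 2 + ‖v‖ ^ 2) < 0 :=
    (show Continuous fun t : ℝ => L v + t * (D v v / 2 + ‖v‖ ^ 2) by
      fun_prop).continuousAt.eventually_lt_const (by simpa using hv)
  obtain ⟨t, ⟨ht1, ht2⟩, ht⟩ := (((h1.and h2).filter_mono nhdsWithin_le_nhds).and
    (self_mem_nhdsWithin (s := Ioi (0 : ℝ)))).exists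
  have ht : 0 < t := ht
  have hv0 : v ≠ 0 := by
    rintro rfl
    simp at hv
  have := H (t • v) ht1 (by
    simp only [map_smul, smul_apply, smul_eq_mul, norm_smul, Real.norm_of_nonneg ht.le]
    nlinarith [mul_neg_of_pos_of_neg ht ht2])
  rw [norm_smul, Real.norm_of_nonneg ht.le, inner_smul_right] at this
  have hn : 0 < ‖v‖ := norm_pos_iff.2 hv0
  have h3 : 0 < t * inner ℝ ν v := by nlinarith [mul_pos ht hn]
  exact pos_of_mul_pos_right h3 ht.le

theorem exists_eq_neg_mul_inner {ν : F} {L : F →L[ℝ] ℝ} (hL : L ≠ 0)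
    (H : ∀ v, L v < 0 → 0 < inner ℝ ν v) : ∃ g > 0, ∀ v, L v = -g * inner ℝ ν v := by
  obtain ⟨w, hw⟩ : ∃ w, L w ≠ 0 := by
    by_contra! h
    exact hL (ContinuousLinearMap.ext h)
  obtain ⟨v₀, hv₀⟩ : ∃ v₀, L v₀ = -1 := ⟨(-(L w)⁻¹) • w, by simp [hw]⟩
  have ha : 0 < inner ℝ ν v₀ := H v₀ (by rw [hv₀]; norm_num)
  have hker : ∀ w, L w = 0 → inner ℝ ν w = 0 := by
    intro w hw
    by_contra hne
    have := H (v₀ + (-inner ℝ ν v₀ / inner ℝ ν w) • w) (by simp [hv₀, hw])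
    rw [inner_add_right, inner_smul_right, div_mul_cancel₀ _ hne] at this
    simp at this
  refine ⟨(inner ℝ ν v₀)⁻¹, inv_pos.2 ha, fun v => ?_⟩
  have := hker (v + L v • v₀) (by simp [hv₀])
  rw [inner_add_right, inner_smul_right] at this
  field_simp
  linarith

/-- If a domain with local model `L h + D h h / 2 < 0` is contained in a ball touching it at the
origin, then the Hessian `D` is positive on the tangent space. -/
theorem le_hessian_tangent_of_supported {ν : F} {L : F →L[ℝ] ℝ} {D : F →L[ℝ] F →L[ℝ] ℝ} {g : ℝ}
    (hg : 0 < g) (hν : ν ≠ 0) (hL : ∀ v, L v = -g * inner ℝ ν v)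
    (H : ∀ ε > 0, ∃ r > 0, ∀ h : F, ‖h‖ < r →
      L h + D h h / 2 + ε * ‖h‖ ^ 2 < 0 → ‖h‖ ^ 2 ≤ 2 * inner ℝ ν h)
    {v : F} (hv : inner ℝ ν v = 0) : g * ‖v‖ ^ 2 ≤ D v v := by
  by_contra! hlt
  have hn : 0 < ‖ν‖ ^ 2 := by positivity
  set β := (D v v + g * ‖v‖ ^ 2) / (4 * g * ‖ν‖ ^ 2) with hβ
  have hβ' : β * (g * ‖ν‖ ^ 2) = (D v v + g * ‖v‖ ^ 2) / 4 := by
    rw [hβ]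
    field_simp
  set ε := (g * ‖v‖ ^ 2 - D v v) / (8 * (‖v‖ ^ 2 + 1)) with hεdef
  have hε : 0 < ε := div_pos (by linarith) (by positivity)
  have hε' : ε * (‖v‖ ^ 2 + 1) = (g * ‖v‖ ^ 2 - D v v) / 8 := by
    rw [hεdef]
    field_simp
  obtain ⟨r, hr, H⟩ := H ε hε
  have h1 : ∀ᶠ t : ℝ in nhds 0, ‖t • v + (β * t ^ 2) • ν‖ < r :=
    (show Continuous fun t : ℝ => ‖t • v + (β * t ^ 2) • ν‖ by
      fun_prop).continuousAt.eventually_lt_const (by simpa using hr)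
  have h2 : ∀ᶠ t : ℝ in nhds 0, -g * (β * ‖ν‖ ^ 2) +
      (D v v + β * t * (D v ν + D ν v) + β ^ 2 * t ^ 2 * D ν ν) / 2 +
      ε * (‖v‖ ^ 2 + β ^ 2 * t ^ 2 * ‖ν‖ ^ 2) < 0 :=
    (show Continuous fun t : ℝ => -g * (β * ‖ν‖ ^ 2) +
      (D v v + β * t * (D v ν + D ν v) + β ^ 2 * t ^ 2 * D ν ν) / 2 +
      ε * (‖v‖ ^ 2 + β ^ 2 * t ^ 2 * ‖ν‖ ^ 2) by
      fun_prop).continuousAt.eventually_lt_const (by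
        simp only [mul_zero, zero_mul, add_zero, ne_eq, OfNat.ofNat_ne_zero, not_false_eq_true,
          zero_pow]
        nlinarith)
  obtain ⟨t, ⟨ht1, ht2⟩, ht⟩ := (((h1.and h2).filter_mono nhdsWithin_le_nhds).and
    (self_mem_nhdsWithin (s := Ioi (0 : ℝ)))).exists
  have ht : 0 < t := ht
  have hnorm : ‖t • v + (β * t ^ 2) • ν‖ ^ 2 =
      t ^ 2 * (‖v‖ ^ 2 + β ^ 2 * t ^ 2 * ‖ν‖ ^ 2) := by
    rw [norm_add_sq_real, inner_smul_left, inner_smul_right, real_inner_comm, hv, norm_smul,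
      norm_smul, mul_pow, mul_pow, Real.norm_eq_abs, Real.norm_eq_abs, sq_abs, sq_abs]
    simp
    ring
  have hinner : inner ℝ ν (t • v + (β * t ^ 2) • ν) = β * t ^ 2 * ‖ν‖ ^ 2 := by
    rw [inner_add_right, inner_smul_right, inner_smul_right, hv, real_inner_self_eq_norm_sq]
    ring
  have := H _ ht1 (by
    rw [hL, hnorm, hinner]
    simp only [map_add, map_smul, add_apply, smul_apply,
      smul_eq_mul]
    have ht2' := mul_neg_of_pos_of_neg (pow_pos ht 2) ht2
    nlinarith)
  rw [hnorm, hinner] at this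
  have h3 : ‖v‖ ^ 2 + β ^ 2 * t ^ 2 * ‖ν‖ ^ 2 ≤ 2 * (β * ‖ν‖ ^ 2) := by
    refine le_of_mul_le_mul_left ?_ (pow_pos ht 2)
    linarith
  have h4 : 0 ≤ β ^ 2 * t ^ 2 * ‖ν‖ ^ 2 := by positivity
  nlinarith

/-- Adding a multiple of `L²` makes a Hessian which is positive on `ker L` positive definite. -/
theorem exists_hessian_add_sq_ge {ν : F} {L : F →L[ℝ] ℝ} {D : F →L[ℝ] F →L[ℝ] ℝ} {g : ℝ}
    (hg : 0 < g) (hν : ν ≠ 0) (hL : ∀ v, L v = -g * inner ℝ ν v)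
    (H : ∀ v, inner ℝ ν v = 0 → g * ‖v‖ ^ 2 ≤ D v v) :
    ∃ K ≥ 0, ∀ h, g / 2 * ‖h‖ ^ 2 ≤ D h h + 2 * K * L h ^ 2 := by
  have hn : 0 < ‖ν‖ := norm_pos_iff.2 hν
  set K := (g / 2 + ‖D‖ + 2 / g * ‖D‖ ^ 2) / (2 * g ^ 2 * ‖ν‖ ^ 2) with hK
  have hK' : 2 * K * (g ^ 2 * ‖ν‖ ^ 2) = g / 2 + ‖D‖ + 2 / g * ‖D‖ ^ 2 := by
    rw [hK]
    field_simp
  refine ⟨K, by positivity, fun h => ?_⟩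
  set s := inner ℝ ν h / ‖ν‖ ^ 2 with hs
  set v := h - s • ν with hv
  have hνv : inner ℝ ν v = 0 := by
    rw [hv, inner_sub_right, inner_smul_right, real_inner_self_eq_norm_sq, hs]
    field_simp
    ring
  have hh : h = v + s • ν := by simp [hv]
  have hLh : L h = -g * (s * ‖ν‖ ^ 2) := by
    rw [hL, hs]
    field_simp
  have hnorm : ‖h‖ ^ 2 = ‖v‖ ^ 2 + s ^ 2 * ‖ν‖ ^ 2 := by
    rw [hh, norm_add_sq_real, inner_smul_right, real_inner_comm, hνv, norm_smul, mul_pow,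
      Real.norm_eq_abs, sq_abs]
    simp
  have hD : D h h = D v v + s * (D v ν + D ν v) + s ^ 2 * D ν ν := by
    conv_lhs => rw [hh]
    simp only [map_add, map_smul, add_apply, smul_apply,
      smul_eq_mul]
    ring
  have hb : ∀ x y, |D x y| ≤ ‖D‖ * ‖x‖ * ‖y‖ := fun x y => D.le_opNorm₂ x y
  have h1 : -(2 * (|s| * (‖D‖ * ‖v‖ * ‖ν‖))) ≤ s * (D v ν + D ν v) := by
    have h2 : |s * (D v ν + D ν v)| ≤ |s| * (2 * (‖D‖ * ‖v‖ * ‖ν‖)) := by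
      rw [abs_mul]
      gcongr
      have := hb ν v
      calc _ ≤ |D v ν| + |D ν v| := abs_add_le _ _
        _ ≤ _ := by nlinarith [hb v ν, hb ν v]
    linarith [neg_abs_le (s * (D v ν + D ν v))]
  have h2 : -(s ^ 2 * (‖D‖ * ‖ν‖ ^ 2)) ≤ s ^ 2 * D ν ν := by
    have := (neg_le_neg (hb ν ν)).trans (neg_abs_le (D ν ν))
    nlinarith [mul_le_mul_of_nonneg_left this (sq_nonneg s)]
  have h3 : 2 * (|s| * (‖D‖ * ‖v‖ * ‖ν‖)) ≤
      g / 2 * ‖v‖ ^ 2 + 2 / g * ‖D‖ ^ 2 * ‖ν‖ ^ 2 * s ^ 2 := by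
    have : 0 ≤ g / 2 * (‖v‖ - 2 / g * (|s| * ‖D‖ * ‖ν‖)) ^ 2 := by positivity
    have h4 : g / 2 * (‖v‖ - 2 / g * (|s| * ‖D‖ * ‖ν‖)) ^ 2 =
        g / 2 * ‖v‖ ^ 2 - 2 * (|s| * (‖D‖ * ‖v‖ * ‖ν‖)) + 2 / g * ‖D‖ ^ 2 * ‖ν‖ ^ 2 * |s| ^ 2 := by
      field_simp
      ring
    rw [sq_abs] at h4
    linarith
  have h5 : 2 * K * L h ^ 2 = (g / 2 + ‖D‖ + 2 / g * ‖D‖ ^ 2) * (s ^ 2 * ‖ν‖ ^ 2) := by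
    rw [hLh, ← hK']
    ring
  rw [h5, hD, hnorm]
  linarith [H v hνv]

end SphericallyExtreme

section LocalDefiningFunction

variable {F : Type*} [NormedAddCommGroup F]

theorem eventually_taylor_two_of_defining [NormedSpace ℝ F] {ρ : F → ℝ} {p : F} {Ω : Set F}
    (hρ : ContDiffAt ℝ 2 ρ p) (hp : ρ p = 0) (hΩ : ∀ᶠ x in nhds p, x ∈ Ω ↔ ρ x < 0)
    {K : ℝ} (hK : 0 ≤ K) {τ : ℝ} (hτ : 0 < τ) :
    ∃ r > 0, ∀ p' ∈ ball p r, ρ p' = 0 → ∀ x ∈ ball p r,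
      (x ∈ Ω → (fderiv ℝ (fderiv ℝ ρ) p (x - p') (x - p') +
        2 * K * fderiv ℝ ρ p (x - p') ^ 2) / 2 - τ * ‖x - p'‖ ^ 2 ≤ -fderiv ℝ ρ p' (x - p')) ∧
      ((fderiv ℝ (fderiv ℝ ρ) p (x - p') (x - p') +
        2 * K * fderiv ℝ ρ p (x - p') ^ 2) / 2 + τ * ‖x - p'‖ ^ 2 < -fderiv ℝ ρ p' (x - p') →
        x ∈ Ω) := by
  set L := fderiv ℝ ρ p
  set ε := min 1 (τ / (1 + K * (2 * ‖L‖ + 1))) with hεdef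
  have hM : 0 < 1 + K * (2 * ‖L‖ + 1) := by positivity
  have hε : 0 < ε := lt_min one_pos (div_pos hτ hM)
  have hε1 : ε ≤ 1 := min_le_left _ _
  have hετ : ε * (1 + K * (2 * ‖L‖ + 1)) ≤ τ := by
    rw [← le_div_iff₀ hM]
    exact min_le_right _ _
  obtain ⟨r₁, hr₁, hT⟩ := exists_ball_norm_taylor_two_le hρ hε
  have hl := (hρ.hasStrictFDerivAt (by norm_num)).isLittleO.def hε
  rw [nhds_prod_eq, Filter.eventually_iff, (nhds_basis_ball.prod_self).mem_iff] at hl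
  obtain ⟨r₂, hr₂, hl⟩ := hl
  have hpos : ∀ᶠ x in nhds p, 0 < 1 + K * ρ x :=
    (continuousAt_const.add (continuousAt_const.mul hρ.continuousAt)).eventually_const_lt
      (by simp [hp])
  obtain ⟨r₃, hr₃, hpos⟩ := Metric.eventually_nhds_iff_ball.1 (hpos.and hΩ)
  refine ⟨min r₁ (min r₂ r₃), lt_min hr₁ (lt_min hr₂ hr₃), fun p' hp' hp0 x hx => ?_⟩
  have h1 : min r₁ (min r₂ r₃) ≤ r₁ := min_le_left _ _
  have h2 : min r₁ (min r₂ r₃) ≤ r₂ := (min_le_right _ _).trans (min_le_left _ _)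
  have h3 : min r₁ (min r₂ r₃) ≤ r₃ := (min_le_right _ _).trans (min_le_right _ _)
  have hT := hT x (ball_subset_ball h1 hx) p' (ball_subset_ball h1 hp')
  have hl := @hl (x, p') ⟨ball_subset_ball h2 hx, ball_subset_ball h2 hp'⟩
  obtain ⟨hpos, hiff⟩ := hpos x (ball_subset_ball h3 hx)
  simp only [Set.mem_ofPred_eq, hp0, sub_zero, Real.norm_eq_abs] at hT hl
  change |ρ x - L (x - p')| ≤ _ at hl
  set h := x - p'
  have hLh : |L h| ≤ ‖L‖ * ‖h‖ := L.le_opNorm h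
  have hsum : |ρ x + L h| ≤ (2 * ‖L‖ + 1) * ‖h‖ := by
    calc |ρ x + L h| = |(ρ x - L h) + (L h + L h)| := by ring_nf
      _ ≤ |ρ x - L h| + (|L h| + |L h|) := (abs_add_le _ _).trans (by gcongr; exact abs_add_le _ _)
      _ ≤ _ := by nlinarith [norm_nonneg h]
  have hsq : |ρ x ^ 2 - L h ^ 2| ≤ ε * (2 * ‖L‖ + 1) * ‖h‖ ^ 2 := by
    calc |ρ x ^ 2 - L h ^ 2| = |ρ x - L h| * |ρ x + L h| := by rw [← abs_mul]; ring_nf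
      _ ≤ (ε * ‖h‖) * ((2 * ‖L‖ + 1) * ‖h‖) := by gcongr
      _ = _ := by ring
  have hKsq : |K * (ρ x ^ 2 - L h ^ 2)| ≤ K * (ε * (2 * ‖L‖ + 1) * ‖h‖ ^ 2) := by
    rw [abs_mul, abs_of_nonneg hK]
    gcongr
  have hτh : ε * ‖h‖ ^ 2 + K * (ε * (2 * ‖L‖ + 1) * ‖h‖ ^ 2) ≤ τ * ‖h‖ ^ 2 := by
    calc _ = (ε * (1 + K * (2 * ‖L‖ + 1))) * ‖h‖ ^ 2 := by ring
      _ ≤ _ := by gcongr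
  rw [abs_le] at hT hKsq
  constructor
  · intro hxΩ
    have := mul_neg_of_neg_of_pos (hiff.1 hxΩ) hpos
    nlinarith
  · intro hlt
    refine hiff.2 ?_
    have : ρ x * (1 + K * ρ x) < 0 := by nlinarith
    exact neg_of_mul_neg_left this hpos.le

/-- A domain lying in a ball lies, seen from boundary points near the contact point, in a paraboloid
which is uniform in the boundary point. -/
theorem exists_mul_norm_sq_le_neg_fderiv [InnerProductSpace ℝ F] {ρ : F → ℝ} {p ν : F}
    {Ω : Set F} {g m K : ℝ} (hρ : ContDiffAt ℝ 2 ρ p) (hp : ρ p = 0)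
    (hΩ : ∀ᶠ x in nhds p, x ∈ Ω ↔ ρ x < 0)
    (hball : ∀ x ∈ Ω, ‖x - p‖ ^ 2 ≤ 2 * inner ℝ ν (x - p)) (hg : 0 < g)
    (hL : ∀ v, fderiv ℝ ρ p v = -g * inner ℝ ν v) (hm : 0 < m) (hK : 0 ≤ K)
    (hQ : ∀ h, m * ‖h‖ ^ 2 ≤ fderiv ℝ (fderiv ℝ ρ) p h h + 2 * K * fderiv ℝ ρ p h ^ 2) :
    ∃ c > 0, ∃ r > 0, ∀ p' ∈ ball p r, ρ p' = 0 → ∀ x ∈ Ω,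
      c * ‖x - p'‖ ^ 2 ≤ -fderiv ℝ ρ p' (x - p') ∧ ‖x - p'‖ ≤ 2 * ‖ν‖ + 1 := by
  obtain ⟨r₁, hr₁, hT⟩ := eventually_taylor_two_of_defining hρ hp hΩ hK
    (show 0 < m / 4 by positivity)
  set L := fderiv ℝ ρ p with hLdef
  set s := g * r₁ ^ 2 / 8 with hs
  have hs0 : 0 < s := by positivity
  set κ := min 1 (s / (2 * ‖ν‖ + 1)) with hκdef
  have hκ : 0 < κ := by positivity
  have hκs : κ * (2 * ‖ν‖) ≤ s := by
    have : κ * (2 * ‖ν‖ + 1) ≤ s := by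
      rw [← le_div_iff₀ (by positivity)]
      exact min_le_right _ _
    linarith
  have hcont : ContinuousAt (fderiv ℝ ρ) p :=
    (hρ.fderiv_right (m := 1) (by norm_num)).continuousAt
  obtain ⟨r₂, hr₂, hcont⟩ := Metric.continuousAt_iff.1 hcont κ hκ
  have hnu : 0 < 2 * ‖ν‖ + 1 := by positivity
  refine ⟨min (m / 4) (2 * s / (2 * ‖ν‖ + 1) ^ 2), by positivity,
    min (min r₁ r₂) (min 1 (s / (‖L‖ + 1))), by positivity, fun p' hp' hp0 x hx => ?_⟩
  rw [mem_ball, lt_min_iff, lt_min_iff, lt_min_iff] at hp'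
  obtain ⟨⟨hp1, hp2⟩, hp3, hp4⟩ := hp'
  have hpn : ‖x - p‖ ≤ 2 * ‖ν‖ := by
    have h1 := hball x hx
    have h2 := real_inner_le_norm ν (x - p)
    by_contra! hlt
    nlinarith [norm_nonneg ν]
  have hpp : ‖p' - p‖ ≤ 1 := by rw [← dist_eq_norm]; exact hp3.le
  have hxp : ‖x - p'‖ ≤ 2 * ‖ν‖ + 1 := by
    calc ‖x - p'‖ = ‖(x - p) - (p' - p)‖ := by congr 1; abel
      _ ≤ _ := (norm_sub_le _ _).trans (by gcongr)
  refine ⟨?_, hxp⟩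
  by_cases hxr : x ∈ ball p r₁
  · have h1 := (hT p' hp1 hp0 x hxr).1 hx
    have h2 : min (m / 4) (2 * s / (2 * ‖ν‖ + 1) ^ 2) * ‖x - p'‖ ^ 2 ≤ m / 4 * ‖x - p'‖ ^ 2 := by
      gcongr
      exact min_le_left _ _
    linarith [hQ (x - p')]
  · have hfar : r₁ ≤ ‖x - p‖ := by
      rw [← dist_eq_norm]
      simpa using hxr
    have h1 : 4 * s ≤ -L (x - p) := by
      rw [hL]
      have h3 := hball x hx
      have : r₁ ^ 2 ≤ ‖x - p‖ ^ 2 := by gcongr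
      have h4 := mul_le_mul_of_nonneg_left (this.trans h3) hg.le
      rw [hs]
      linarith
    have hd := (hcont hp2).le
    rw [dist_eq_norm] at hd
    set L' := fderiv ℝ ρ p'
    have h2 : |(L' - L) (x - p)| ≤ s := by
      calc _ ≤ ‖L' - L‖ * ‖x - p‖ := (L' - L).le_opNorm _
        _ ≤ κ * (2 * ‖ν‖) := by gcongr
        _ ≤ s := hκs
    have h3 : |L' (p' - p)| ≤ s := by
      have hL' : ‖L'‖ ≤ ‖L‖ + 1 := by
        calc ‖L'‖ = ‖L + (L' - L)‖ := by congr 1; abel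
          _ ≤ ‖L‖ + 1 := (norm_add_le _ _).trans (by gcongr; exact hd.trans (min_le_left _ _))
      rw [dist_eq_norm, lt_div_iff₀ (by positivity)] at hp4
      calc _ ≤ ‖L'‖ * ‖p' - p‖ := L'.le_opNorm _
        _ ≤ (‖L‖ + 1) * ‖p' - p‖ := by gcongr
        _ ≤ s := by linarith
    have h4 : -L' (x - p') = -L (x - p) - (L' - L) (x - p) + L' (p' - p) := by
      simp only [map_sub, sub_apply]
      ring
    have h5 : 2 * s ≤ -L' (x - p') := by
      rw [abs_le] at h2 h3
      linarith
    calc _ ≤ 2 * s / (2 * ‖ν‖ + 1) ^ 2 * (2 * ‖ν‖ + 1) ^ 2 := by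
          gcongr
          exact min_le_right _ _
      _ = 2 * s := by field_simp
      _ ≤ _ := h5

/-- Points of the domain near `p` project to the boundary along a fixed transverse direction. -/
theorem exists_boundary_projection [NormedSpace ℝ F] {ρ : F → ℝ} {p N : F} {Ω : Set F}
    (hρ : ContDiffAt ℝ 2 ρ p) (hp : ρ p = 0) (hΩ : ∀ᶠ x in nhds p, x ∈ Ω ↔ ρ x < 0)
    (hN : fderiv ℝ ρ p N < 0) {r : ℝ} (hr : 0 < r) :
    ∃ r' > 0, ∀ q ∈ Ω ∩ ball p r', ∃ t ∈ Ioo 0 r, ρ (q - t • N) = 0 ∧ q - t • N ∈ ball p r := by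
  have hc : ∀ᶠ x in nhds p, ContinuousAt ρ x :=
    (hρ.eventually (by simp)).mono fun x hx => hx.continuousAt
  obtain ⟨r₁, hr₁, hc⟩ := Metric.eventually_nhds_iff_ball.1 (hc.and hΩ)
  set s := min r r₁ with hsdef
  have hs : 0 < s := lt_min hr hr₁
  have hline : HasDerivAt (fun t : ℝ => ρ (p - t • N)) (-fderiv ℝ ρ p N) 0 := by
    have h1 : HasDerivAt (fun t : ℝ => p - t • N) (-N) 0 := by
      simpa using ((hasDerivAt_id (0 : ℝ)).smul_const N).const_sub p
    have h2 : HasFDerivAt ρ (fderiv ℝ ρ p) (p - (0 : ℝ) • N) := by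
      simpa using (hρ.differentiableAt (by norm_num)).hasFDerivAt
    exact (h2.comp_hasDerivAt 0 h1).congr_deriv (by simp)
  have hpos : ∀ᶠ t : ℝ in nhdsWithin 0 (Ioi 0), 0 < ρ (p - t • N) := by
    have := hline.hasDerivWithinAt (s := Ioi 0)
    rw [hasDerivWithinAt_iff_tendsto_slope' (by simp)] at this
    filter_upwards [this.eventually_const_lt (show 0 < -fderiv ℝ ρ p N by linarith),
      self_mem_nhdsWithin] with t ht ht0
    have ht0 : 0 < t := ht0
    rw [slope_def_field] at ht
    simpa [hp, ht0, div_pos_iff_of_pos_right] using ht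
  have hsmall : ∀ᶠ t : ℝ in nhdsWithin 0 (Ioi 0), t * ‖N‖ < s / 2 ∧ t < r :=
    Filter.Eventually.filter_mono nhdsWithin_le_nhds
      (((show Continuous fun t : ℝ => t * ‖N‖ by fun_prop).continuousAt.eventually_lt_const
        (by simpa using hs)).and (eventually_lt_nhds hr))
  obtain ⟨t₁, ⟨ht₁pos, ht₁N, ht₁r⟩, ht₁⟩ :=
    ((hpos.and hsmall).and self_mem_nhdsWithin).exists
  have ht₁ : 0 < t₁ := ht₁
  have hmem : ∀ q ∈ ball p (s / 2), ∀ t ∈ Icc 0 t₁, q - t • N ∈ ball p s := by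
    intro q hq t ht
    rw [mem_ball, dist_eq_norm] at hq ⊢
    calc ‖q - t • N - p‖ = ‖(q - p) - t • N‖ := by congr 1; abel
      _ ≤ ‖q - p‖ + ‖t • N‖ := norm_sub_le _ _
      _ = ‖q - p‖ + t * ‖N‖ := by rw [norm_smul, Real.norm_of_nonneg ht.1]
      _ ≤ ‖q - p‖ + t₁ * ‖N‖ := by gcongr; exact ht.2
      _ < s := by linarith
  have hev : ∀ᶠ q in nhds p, 0 < ρ (q - t₁ • N) := by
    have h1 : ContinuousAt ρ (p - t₁ • N) :=
      (hc _ (ball_subset_ball (min_le_right _ _)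
        (hmem p (mem_ball_self (by positivity)) t₁ ⟨ht₁.le, le_rfl⟩))).1
    have h2 : ContinuousAt (fun q => ρ (q - t₁ • N)) p :=
      ContinuousAt.comp (f := fun q => q - t₁ • N) h1 (by fun_prop)
    exact h2.eventually_const_lt ht₁pos
  obtain ⟨r₂, hr₂, hev⟩ := Metric.eventually_nhds_iff_ball.1 hev
  refine ⟨min r₂ (s / 2), by positivity, fun q ⟨hqΩ, hq⟩ => ?_⟩
  have hq2 : q ∈ ball p (s / 2) := ball_subset_ball (min_le_right _ _) hq
  have hcont : ContinuousOn (fun t : ℝ => ρ (q - t • N)) (Icc 0 t₁) := by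
    intro t ht
    refine ContinuousAt.continuousWithinAt ?_
    exact ContinuousAt.comp (f := fun t : ℝ => q - t • N)
      (hc _ (ball_subset_ball (min_le_right _ _) (hmem q hq2 t ht))).1 (by fun_prop)
  have hq0 : ρ q < 0 := by
    have := hmem q hq2 0 ⟨le_rfl, ht₁.le⟩
    rw [zero_smul, sub_zero] at this
    exact ((hc q (ball_subset_ball (min_le_right _ _) this)).2).1 hqΩ
  obtain ⟨t, ht, htρ⟩ := intermediate_value_Ioo ht₁.le hcont
    (show (0 : ℝ) ∈ Ioo _ _ from ⟨by simpa using hq0,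
      hev q (ball_subset_ball (min_le_left _ _) hq)⟩)
  exact ⟨t, ⟨ht.1, ht.2.trans ht₁r⟩, htρ,
    ball_subset_ball (min_le_left _ _) (hmem q hq2 t ⟨ht.1.le, ht.2.le⟩)⟩

end LocalDefiningFunction

theorem exists_linearEquiv_norm_sq_eq_core {V W : Type*} [AddCommGroup V] [Module ℂ V]
    [FiniteDimensional ℂ V] [NormedAddCommGroup W] [InnerProductSpace ℂ W]
    [FiniteDimensional ℂ W] (h : Module.finrank ℂ V = Module.finrank ℂ W)
    (core : InnerProductSpace.Core ℂ V) :
    ∃ M : V ≃ₗ[ℂ] W, ∀ x, ‖M x‖ ^ 2 = (core.inner x x).re := by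
  let := core.toNormedAddCommGroup
  let : InnerProductSpace ℂ V := InnerProductSpace.ofCore core.toCore
  let M := ((stdOrthonormalBasis ℂ V).reindex (finCongr h)).repr.trans
    (stdOrthonormalBasis ℂ W).repr.symm
  refine ⟨M.toLinearEquiv, fun x => ?_⟩
  have h1 : ‖M x‖ = ‖x‖ := M.norm_map x
  have h2 : ‖x‖ ^ 2 = RCLike.re (inner ℂ x x) := (inner_self_eq_norm_sq (𝕜 := ℂ) x).symm
  exact (congrArg (· ^ 2) h1).trans h2

section HermitianParts

variable {V : Type*} [NormedAddCommGroup V] [InnerProductSpace ℂ V]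

theorem complex_smul_eq_re_add_im (c : ℂ) (x : V) :
    c • x = c.re • x + c.im • (Complex.I • x) := by
  rw [RCLike.real_smul_eq_coe_smul (K := ℂ), RCLike.real_smul_eq_coe_smul (K := ℂ) c.im,
    smul_smul, ← add_smul]
  congr 1
  exact (Complex.re_add_im c).symm

/-- The Hermitian part of a positive definite real quadratic form is the square of a Hermitian norm,
up to a complex linear change of coordinates. -/
theorem exists_linearEquiv_norm_sq_eq_hermitian [FiniteDimensional ℂ V]
    (D : V →L[ℝ] V →L[ℝ] ℝ) (hsymm : ∀ x y, D x y = D y x) {m : ℝ} (hm : 0 < m)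
    (hD : ∀ h, m * ‖h‖ ^ 2 ≤ D h h) :
    ∃ M : V ≃ₗ[ℂ] V, ∀ x, ‖M x‖ ^ 2 = (D x x + D (Complex.I • x) (Complex.I • x)) / 4 := by
  let core : InnerProductSpace.Core ℂ V :=
    { inner := fun x y => ⟨(D x y + D (Complex.I • x) (Complex.I • y)) / 4,
        (D (Complex.I • x) y - D x (Complex.I • y)) / 4⟩
      conj_inner_symm := fun x y => by
        apply Complex.ext
        · simp [hsymm x, hsymm (Complex.I • x)]
        · simp [hsymm x, hsymm (Complex.I • x)]
          ring
      re_inner_nonneg := fun x => by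
        have h1 := hD x
        have h2 := hD (Complex.I • x)
        have h3 : 0 ≤ m * ‖x‖ ^ 2 := by positivity
        have h4 : 0 ≤ m * ‖Complex.I • x‖ ^ 2 := by positivity
        change 0 ≤ (D x x + D (Complex.I • x) (Complex.I • x)) / 4
        linarith
      add_left := fun x y z => by
        apply Complex.ext <;> simp <;> ring
      smul_left := fun x y c => by
        have h1 : Complex.I • c • x = c.re • (Complex.I • x) - c.im • x := by
          rw [smul_smul, complex_smul_eq_re_add_im (Complex.I * c)]
          simp
          abel
        apply Complex.ext
        · simp only [h1]
          rw [complex_smul_eq_re_add_im c x]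
          simp
          ring
        · simp only [h1]
          rw [complex_smul_eq_re_add_im c x]
          simp
          ring
      definite := fun x hx => by
        have h1 := hD x
        have h2 := hD (Complex.I • x)
        have h5 : (D x x + D (Complex.I • x) (Complex.I • x)) / 4 = 0 := congrArg Complex.re hx
        have h4 : 0 ≤ m * ‖Complex.I • x‖ ^ 2 := by positivity
        by_contra hne
        have h3 : 0 < m * ‖x‖ ^ 2 := by positivity
        linarith }
  exact exists_linearEquiv_norm_sq_eq_core rfl core

theorem exists_bilinear_re_eq_of_real_bilinear [FiniteDimensional ℂ V]
    (D : V →L[ℝ] V →L[ℝ] ℝ) :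
    ∃ B : V →ₗ[ℂ] V →ₗ[ℂ] ℂ, ∀ x,
      (B x x).re = (D x x - D (Complex.I • x) (Complex.I • x)) / 4 := by
  have h1 : ∀ (c : ℂ) (x : V), Complex.I • c • x = c.re • (Complex.I • x) - c.im • x := by
    intro c x
    rw [smul_smul, complex_smul_eq_re_add_im (Complex.I * c)]
    simp
    abel
  let B : V →ₗ[ℂ] V →ₗ[ℂ] ℂ := LinearMap.mk₂ ℂ
    (fun x y => (⟨(D x y - D (Complex.I • x) (Complex.I • y)) / 4,
      -(D (Complex.I • x) y + D x (Complex.I • y)) / 4⟩ : ℂ))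
    (fun x y z => by apply Complex.ext <;> simp <;> ring)
    (fun c x y => by
      apply Complex.ext <;> simp only [h1] <;> rw [complex_smul_eq_re_add_im c x] <;> simp <;> ring)
    (fun x y z => by apply Complex.ext <;> simp <;> ring)
    (fun c x y => by
      apply Complex.ext <;> simp only [h1] <;> rw [complex_smul_eq_re_add_im c y] <;> simp <;> ring)
  exact ⟨B, fun x => rfl⟩

/-- A positive definite real quadratic form and a nonzero complex functional are brought to the
form `μ (‖M h‖² + Re B (M h) (M h))` and `μ ⟪e, M h⟫` by a complex linear change of coordinates. -/
theorem exists_hermitian_normal_form [FiniteDimensional ℂ V]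
    (D : V →L[ℝ] V →L[ℝ] ℝ) (hsymm : ∀ x y, D x y = D y x) {m : ℝ} (hm : 0 < m)
    (hD : ∀ h, m * ‖h‖ ^ 2 ≤ D h h) {ℓ : V →L[ℂ] ℂ} (hℓ : ℓ ≠ 0) :
    ∃ μ > 0, ∃ (M : V ≃L[ℂ] V) (e : V) (B : V →L[ℂ] V →L[ℂ] ℂ), ‖e‖ = 1 ∧
      (∀ h, D h h / 2 = μ * (‖M h‖ ^ 2 + (B (M h) (M h)).re)) ∧
      ∀ h, ℓ h = μ * inner ℂ e (M h) := by
  obtain ⟨M₀, hM₀⟩ := exists_linearEquiv_norm_sq_eq_hermitian D hsymm hm hD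
  obtain ⟨B₀, hB₀⟩ := exists_bilinear_re_eq_of_real_bilinear D
  set a : V := (InnerProductSpace.toDual ℂ V).symm
    (ℓ.comp (M₀.symm.toContinuousLinearEquiv : V →L[ℂ] V)) with hadef
  have ha : ∀ h, inner ℂ a (M₀ h) = ℓ h := by
    intro h
    rw [hadef, InnerProductSpace.toDual_symm_apply]
    simp
  have ha0 : a ≠ 0 := by
    intro h0
    refine hℓ (ContinuousLinearMap.ext fun h => ?_)
    rw [← ha, h0, inner_zero_left]
    rfl
  have hs : 0 < ‖a‖ := norm_pos_iff.2 ha0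
  have hs' : ((‖a‖⁻¹ : ℝ) : ℂ) ≠ 0 := by exact_mod_cast (inv_pos.2 hs).ne'
  let M : V ≃L[ℂ] V := (M₀.trans (LinearEquiv.smulOfNeZero ℂ V _ hs')).toContinuousLinearEquiv
  have hM : ∀ h, M h = ((‖a‖⁻¹ : ℝ) : ℂ) • M₀ h := fun h => rfl
  let B₁ : V →ₗ[ℂ] V →ₗ[ℂ] ℂ :=
    (((‖a‖ ^ 2)⁻¹ : ℝ) : ℂ) • B₀.compl₁₂ (M.symm : V →ₗ[ℂ] V) (M.symm : V →ₗ[ℂ] V)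
  refine ⟨‖a‖ ^ 2, by positivity, M, ((‖a‖⁻¹ : ℝ) : ℂ) • a, LinearMap.toContinuousLinearMap
    ((LinearMap.toContinuousLinearMap : (V →ₗ[ℂ] ℂ) ≃ₗ[ℂ] (V →L[ℂ] ℂ)).toLinearMap ∘ₗ B₁),
    ?_, fun h => ?_, fun h => ?_⟩
  · rw [norm_smul, Complex.norm_real, Real.norm_of_nonneg (by positivity), inv_mul_cancel₀ hs.ne']
  · have h1 : (B₁ (M h) (M h)).re = (‖a‖ ^ 2)⁻¹ * (B₀ h h).re := by
      simp only [B₁, LinearMap.smul_apply, LinearMap.compl₁₂_apply]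
      have : (M.symm : V →ₗ[ℂ] V) (M h) = h := M.symm_apply_apply h
      rw [this, smul_eq_mul, Complex.re_ofReal_mul]
    change D h h / 2 = ‖a‖ ^ 2 * (‖M h‖ ^ 2 + (B₁ (M h) (M h)).re)
    rw [h1, hB₀, hM, norm_smul, mul_pow, hM₀, Complex.norm_real, Real.norm_of_nonneg (by positivity)]
    field_simp
    ring
  · rw [hM, inner_smul_left, inner_smul_right, ha, Complex.conj_ofReal]
    push_cast
    have : (‖a‖ : ℂ) ≠ 0 := by exact_mod_cast hs.ne'
    field_simp

end HermitianParts

theorem exists_definite_quadratic_of_supported {F : Type*} [NormedAddCommGroup F]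
    [InnerProductSpace ℝ F] {ρ : F → ℝ} {p a : F} {Ω : Set F} (hρ : ContDiffAt ℝ 2 ρ p)
    (hp : ρ p = 0) (hL : fderiv ℝ ρ p ≠ 0) (hΩ : ∀ᶠ x in nhds p, x ∈ Ω ↔ ρ x < 0)
    (hball : Ω ⊆ ball a ‖p - a‖) :
    ∃ m > 0, ∃ K ≥ 0,
      (∀ h, m * ‖h‖ ^ 2 ≤ fderiv ℝ (fderiv ℝ ρ) p h h + 2 * K * fderiv ℝ ρ p h ^ 2) ∧
      ∃ c > 0, ∃ C, ∃ r > 0, ∀ p' ∈ ball p r, ρ p' = 0 → ∀ x ∈ Ω,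
        c * ‖x - p'‖ ^ 2 ≤ -fderiv ℝ ρ p' (x - p') ∧ ‖x - p'‖ ≤ C := by
  set ν := a - p with hν
  have hball' : ∀ x ∈ Ω, ‖x - p‖ ^ 2 ≤ 2 * inner ℝ ν (x - p) := by
    intro x hx
    have h1 := hball hx
    rw [mem_ball, dist_eq_norm, show x - a = (x - p) - ν by rw [hν]; abel,
      show ‖p - a‖ = ‖ν‖ by rw [hν, norm_sub_rev]] at h1
    have h2 : ‖(x - p) - ν‖ ^ 2 < ‖ν‖ ^ 2 := by gcongr
    rw [norm_sub_sq_real, real_inner_comm] at h2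
    linarith
  have H : ∀ ε > 0, ∃ r > 0, ∀ h : F, ‖h‖ < r →
      fderiv ℝ ρ p h + fderiv ℝ (fderiv ℝ ρ) p h h / 2 + ε * ‖h‖ ^ 2 < 0 →
      ‖h‖ ^ 2 ≤ 2 * inner ℝ ν h := by
    intro ε hε
    obtain ⟨r₁, hr₁, hT⟩ := exists_ball_norm_taylor_two_le hρ hε
    obtain ⟨r₂, hr₂, hΩ⟩ := Metric.eventually_nhds_iff_ball.1 hΩ
    refine ⟨min r₁ r₂, lt_min hr₁ hr₂, fun h hh hneg => ?_⟩
    have h1 : p + h ∈ ball p r₁ := by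
      rw [mem_ball, dist_self_add_left]
      exact hh.trans_le (min_le_left _ _)
    have h2 : p + h ∈ ball p r₂ := by
      rw [mem_ball, dist_self_add_left]
      exact hh.trans_le (min_le_right _ _)
    have h3 := hT _ h1 p (mem_ball_self hr₁)
    rw [add_sub_cancel_left, hp, abs_le] at h3
    have h4 := hball' _ ((hΩ _ h2).2 (by linarith))
    rwa [add_sub_cancel_left] at h4
  obtain ⟨g, hg, hLg⟩ := exists_eq_neg_mul_inner hL fun v => inner_pos_of_supported H
  have hν0 : ν ≠ 0 := by
    intro h0
    refine hL (ContinuousLinearMap.ext fun v => ?_)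
    rw [hLg, h0]
    simp
  obtain ⟨K, hK, hQ⟩ := exists_hessian_add_sq_ge hg hν0 hLg
    fun v => le_hessian_tangent_of_supported hg hν0 hLg H
  obtain ⟨c, hc, r, hr, hG⟩ := exists_mul_norm_sq_le_neg_fderiv hρ hp hΩ hball' hg hLg
    (half_pos hg) hK hQ
  exact ⟨g / 2, half_pos hg, K, hK, hQ, c, hc, _, r, hr, hG⟩

theorem norm_smul_extendRCLike_comp_sub_innerSL_le {V : Type*} [NormedAddCommGroup V]
    [InnerProductSpace ℂ V] {e : V} {μ κ : ℝ} (hμ : 0 < μ) (hκ : 0 ≤ κ) {L L' : V →L[ℝ] ℝ}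
    {M : V ≃L[ℂ] V}
    (hL : ∀ h, (StrongDual.extendRCLike L : StrongDual ℂ V) h = μ * inner ℂ e (M h))
    (hLL' : ‖L' - L‖ ≤ κ) :
    ‖(μ⁻¹ : ℂ) • (StrongDual.extendRCLike L' : StrongDual ℂ V).comp (M.symm : V →L[ℂ] V) -
      innerSL ℂ e‖ ≤ μ⁻¹ * (κ * ‖(M.symm : V →L[ℂ] V)‖) := by
  refine ContinuousLinearMap.opNorm_le_bound _ (by positivity) fun y => ?_
  have hμ' : (μ : ℂ) ≠ 0 := by exact_mod_cast hμ.ne'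
  have h1 : ((μ⁻¹ : ℂ) • (StrongDual.extendRCLike L' : StrongDual ℂ V).comp
      (M.symm : V →L[ℂ] V) - innerSL ℂ e) y =
      (μ⁻¹ : ℂ) • (StrongDual.extendRCLike (L' - L) : StrongDual ℂ V) (M.symm y) := by
    have h2 : innerSL ℂ e y =
        (μ⁻¹ : ℂ) * (StrongDual.extendRCLike L : StrongDual ℂ V) (M.symm y) := by
      rw [hL, M.apply_symm_apply, innerSL_apply_apply]
      field_simp
    rw [sub_apply, h2]
    simp only [smul_apply, ContinuousLinearMap.comp_apply, ContinuousLinearEquiv.coe_coe,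
      StrongDual.extendRCLike_apply, sub_apply, smul_eq_mul]
    push_cast
    ring
  have h3 : ‖(μ⁻¹ : ℂ)‖ = μ⁻¹ := by
    rw [norm_inv, Complex.norm_real, Real.norm_of_nonneg hμ.le]
  rw [h1, norm_smul, h3, mul_assoc]
  gcongr
  calc _ ≤ ‖L' - L‖ * ‖M.symm y‖ := StrongDual.norm_extendRCLike_bound _ _
    _ ≤ κ * (‖(M.symm : V →L[ℂ] V)‖ * ‖y‖) := by
        gcongr
        exact (M.symm : V →L[ℂ] V).le_opNorm y
    _ = _ := by ring

/-- Near a boundary point at which `Ω` touches the boundary of a ball containing it, `Ω` can be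
mapped biholomorphically onto almost the unit ball, with the given point going almost to `0`. -/
theorem exists_map_near_ball_of_supported {V : Type*} [NormedAddCommGroup V]
    [InnerProductSpace ℂ V] [FiniteDimensional ℂ V] {ρ : V → ℝ} {p a : V} {Ω : Set V}
    (hρ : ContDiffAt ℝ 2 ρ p) (hp : ρ p = 0) (hL : fderiv ℝ ρ p ≠ 0)
    (hΩ : ∀ᶠ x in nhds p, x ∈ Ω ↔ ρ x < 0) (hball : Ω ⊆ ball a ‖p - a‖) {ε : ℝ} (hε : 0 < ε) :
    ∃ e : V, ‖e‖ = 1 ∧ ∃ r > 0, ∀ q ∈ Ω ∩ ball p r, ∃ F : V → V,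
      DifferentiableOn ℂ F Ω ∧ InjOn F Ω ∧ F '' Ω ⊆ ball 0 (1 + ε) ∧
      ball 0 (1 - ε) ⊆ F '' Ω ∧ ‖F q‖ ≤ ε := by
  let : InnerProductSpace ℝ V := InnerProductSpace.complexToReal
  obtain ⟨m, hm, K, hK, hQ, c, hc, C, r₂, hr₂, hG⟩ :=
    exists_definite_quadratic_of_supported hρ hp hL hΩ hball
  have hcont : ContinuousAt (fderiv ℝ ρ) p :=
    (hρ.fderiv_right (m := 1) (by norm_num)).continuousAt
  have hsymm : IsSymmSndFDerivAt ℝ ρ p := hρ.isSymmSndFDerivAt (by simp)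
  set L := fderiv ℝ ρ p with hLdef
  set Q : V →L[ℝ] V →L[ℝ] ℝ := fderiv ℝ (fderiv ℝ ρ) p + (2 * K) • L.smulRight L with hQdef
  have hQapp : ∀ x y, Q x y = fderiv ℝ (fderiv ℝ ρ) p x y + 2 * K * (L x * L y) := by
    intro x y
    simp [hQdef]
  have hQapp' : ∀ x, Q x x = fderiv ℝ (fderiv ℝ ρ) p x x + 2 * K * L x ^ 2 := by
    intro x
    rw [hQapp, sq]
  have hℓ : (StrongDual.extendRCLike (-L) : StrongDual ℂ V) ≠ 0 := by
    intro h0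
    refine hL (ContinuousLinearMap.ext fun v => ?_)
    have := StrongDual.re_extendRCLike_apply (𝕜 := ℂ) (-L) v
    rw [h0] at this
    simpa using this.symm
  obtain ⟨μ, hμ, M, e, B, he, hMQ, hMℓ⟩ := exists_hermitian_normal_form Q
    (fun x y => by rw [hQapp, hQapp, hsymm.eq x y, mul_comm (L x)]) hm
    (fun h => by rw [hQapp']; exact hQ h) hℓ
  have hMℓ' : ∀ h, (StrongDual.extendRCLike (-L) : StrongDual ℂ V) h = μ * inner ℂ e (M h) := hMℓ
  set A := ‖(M : V →L[ℂ] V)‖ + 1 with hA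
  set A' := ‖(M.symm : V →L[ℂ] V)‖ + 1 with hA'
  have hA0 : 0 < A := by positivity
  have hA0' : 0 < A' := by positivity
  have hMA : ∀ x, ‖M x‖ ≤ A * ‖x‖ := fun x =>
    ((M : V →L[ℂ] V).le_opNorm x).trans (by gcongr; linarith)
  have hMA' : ∀ x, ‖M.symm x‖ ≤ A' * ‖x‖ := fun x =>
    ((M.symm : V →L[ℂ] V).le_opNorm x).trans (by gcongr; linarith)
  refine ⟨e, he, ?_⟩
  obtain ⟨τ, hτ, hF⟩ := exists_map_near_ball he B (c := c / (μ * A ^ 2)) (A * C)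
    (by positivity) hε
  obtain ⟨r₁, hr₁, hT⟩ := eventually_taylor_two_of_defining hρ hp hΩ hK
    (show 0 < τ * μ / A' ^ 2 by positivity)
  obtain ⟨r₃, hr₃, hcont⟩ := Metric.continuousAt_iff.1 hcont (τ * μ / A') (by positivity)
  obtain ⟨δ₀, hδ₀, hF⟩ := hF (r₁ / (2 * A')) (by positivity)
  have hN : L (M.symm e) < 0 := by
    have h1 := StrongDual.re_extendRCLike_apply (𝕜 := ℂ) (-L) (M.symm e)
    rw [hMℓ', M.apply_symm_apply, inner_self_eq_norm_sq_to_K, he] at h1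
    simp at h1
    linarith
  obtain ⟨r, hr, hP⟩ := exists_boundary_projection hρ hp hΩ hN
    (show 0 < min (min (r₁ / 2) r₂) (min r₃ δ₀) by positivity)
  refine ⟨r, hr, fun q hq => ?_⟩
  obtain ⟨t, ⟨ht, htr⟩, ht0, htp⟩ := hP q hq
  set p' := q - t • M.symm e with hp'
  rw [lt_min_iff, lt_min_iff, lt_min_iff] at htr
  rw [mem_ball, lt_min_iff, lt_min_iff, lt_min_iff] at htp
  obtain ⟨⟨hpr₁, hpr₂⟩, hpr₃, -⟩ := htp
  set L' := fderiv ℝ ρ p' with hL'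
  set ℓ : V →L[ℂ] ℂ := (μ⁻¹ : ℂ) • (StrongDual.extendRCLike (-L') : StrongDual ℂ V).comp
    (M.symm : V →L[ℂ] V) with hℓdef
  have hℓre : ∀ y, (ℓ y).re = μ⁻¹ * -L' (M.symm y) := by
    intro y
    have h1 := StrongDual.re_extendRCLike_apply (𝕜 := ℂ) (-L') (M.symm y)
    have h2 : ℓ y = ((μ⁻¹ : ℝ) : ℂ) *
        (StrongDual.extendRCLike (-L') : StrongDual ℂ V) (M.symm y) := by
      simp [hℓdef]
    rw [h2, Complex.re_ofReal_mul]
    exact congrArg (μ⁻¹ * ·) h1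
  have hsub : ∀ y, p' + M.symm y - p' = M.symm y := fun y => add_sub_cancel_left _ _
  have hnear : ∀ y, ‖y‖ < r₁ / (2 * A') → p' + M.symm y ∈ ball p r₁ := by
    intro y hy
    rw [lt_div_iff₀ (by positivity)] at hy
    rw [dist_eq_norm] at hpr₁
    rw [mem_ball, dist_eq_norm]
    calc ‖p' + M.symm y - p‖ = ‖(p' - p) + M.symm y‖ := by congr 1; abel
      _ ≤ ‖p' - p‖ + A' * ‖y‖ := (norm_add_le _ _).trans (by gcongr; exact hMA' y)
      _ < r₁ := by linarith
  have hpball : p' ∈ ball p r₁ := by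
    rw [mem_ball]
    linarith
  have hquad : ∀ y, μ⁻¹ * ((fderiv ℝ (fderiv ℝ ρ) p (M.symm y) (M.symm y) +
      2 * K * L (M.symm y) ^ 2) / 2) = ‖y‖ ^ 2 + (B y y).re := by
    intro y
    rw [← hQapp', hMQ, M.apply_symm_apply]
    field_simp
  have hτy : ∀ y, μ⁻¹ * (τ * μ / A' ^ 2 * ‖M.symm y‖ ^ 2) ≤ τ * ‖y‖ ^ 2 := by
    intro y
    have h1 : ‖M.symm y‖ ^ 2 ≤ (A' * ‖y‖) ^ 2 := by
      gcongr
      exact hMA' y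
    calc _ ≤ μ⁻¹ * (τ * μ / A' ^ 2 * (A' * ‖y‖) ^ 2) := by gcongr
      _ = _ := by field_simp
  obtain ⟨G, hGd, hGi, hG1, hG2, hGq⟩ := hF {y | p' + M.symm y ∈ Ω} ℓ t (by
    refine (norm_smul_extendRCLike_comp_sub_innerSL_le hμ (κ := τ * μ / A') (by positivity)
      hMℓ' ?_).trans ?_
    · rw [← neg_sub', norm_neg, ← dist_eq_norm]
      exact (hcont hpr₃).le
    · have : ‖(M.symm : V →L[ℂ] V)‖ ≤ A' := by linarith
      calc _ ≤ μ⁻¹ * (τ * μ / A' * A') := by gcongr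
        _ = τ := by field_simp) ht htr.2.2.le
    (fun y hy => by
      obtain ⟨h1, h2⟩ := hG p' hpr₂ ht0 _ hy
      rw [hsub] at h1 h2
      have h3 : ‖y‖ ≤ A * ‖M.symm y‖ := by
        simpa using hMA (M.symm y)
      refine ⟨?_, h3.trans (by gcongr)⟩
      rw [hℓre]
      calc c / (μ * A ^ 2) * ‖y‖ ^ 2 ≤ c / (μ * A ^ 2) * (A * ‖M.symm y‖) ^ 2 := by gcongr
        _ = μ⁻¹ * (c * ‖M.symm y‖ ^ 2) := by field_simp
        _ ≤ _ := by gcongr)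
    (fun y hy hyη => by
      have h1 := (hT p' hpball ht0 _ (hnear y hyη)).1 hy
      rw [hsub] at h1
      have h2 := mul_le_mul_of_nonneg_left h1 (inv_pos.2 hμ).le
      rw [mul_sub, hquad] at h2
      rw [hℓre]
      linarith [hτy y])
    (fun y hyη hlt => by
      refine (hT p' hpball ht0 _ (hnear y hyη)).2 ?_
      rw [hsub]
      refine lt_of_mul_lt_mul_left ?_ (inv_pos.2 hμ).le
      rw [mul_add, hquad, ← hℓre]
      linarith [hτy y])
  have hmaps : ∀ x, p' + M.symm (M (x - p')) = x := fun x => by simp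
  have himage : (fun x => G (M (x - p'))) '' Ω = G '' {y | p' + M.symm y ∈ Ω} := by
    ext z
    constructor
    · rintro ⟨x, hx, rfl⟩
      exact ⟨M (x - p'), by rwa [Set.mem_ofPred_eq, hmaps], rfl⟩
    · rintro ⟨y, hy, rfl⟩
      exact ⟨p' + M.symm y, hy, by simp⟩
  refine ⟨fun x => G (M (x - p')), ?_, ?_, himage ▸ hG1, himage ▸ hG2, ?_⟩
  · refine hGd.comp (t := {y | p' + M.symm y ∈ Ω}) (Differentiable.differentiableOn ?_) fun x hx => by
      rwa [Set.mem_ofPred_eq, hmaps]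
    exact M.differentiable.comp (differentiable_id.sub_const p')
  · intro x hx x' hx' heq
    have h1 := hGi (by rwa [Set.mem_ofPred_eq, hmaps]) (by rwa [Set.mem_ofPred_eq, hmaps]) heq
    exact sub_left_injective (M.injective h1)
  · have h1 : M (q - p') = (t : ℂ) • e := by
      rw [hp', sub_sub_cancel, RCLike.real_smul_eq_coe_smul (K := ℂ), map_smul, M.apply_symm_apply]
      rfl
    change ‖G (M (q - p'))‖ ≤ ε
    rw [h1]
    exact hGq

/-- If `Ω ⊆ ℂⁿ` is a bounded domain and `p ∈ ∂Ω` is a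
spherically-extreme boundary point (local `C²` defining function with nonvanishing
gradient near `p`, and a ball containing `Ω` touching `∂Ω` at `p`), then
`σ_Ω(q) → 1` as `Ω ∋ q → p`. -/
theorem squeezing_tendsto_one_spherically_extreme (n : ℕ)
    (Ω : Set (EuclideanSpace ℂ (Fin n)))
    (hopen : IsOpen Ω) (hconn : IsConnected Ω) (hbdd : Bornology.IsBounded Ω)
    (p : EuclideanSpace ℂ (Fin n)) (hp : p ∈ frontier Ω)
    (r₀ : ℝ) (hr₀ : 0 < r₀)
    (ρ : EuclideanSpace ℂ (Fin n) → ℝ)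
    (hρ : ContDiffOn ℝ 2 ρ (ball p r₀))
    (hgrad : ∀ x ∈ ball p r₀, fderiv ℝ ρ x ≠ 0)
    (hdef : Ω ∩ ball p r₀ = {x | ρ x < 0} ∩ ball p r₀)
    (c : EuclideanSpace ℂ (Fin n)) (R : ℝ) (hR : 0 < R)
    (hΩball : Ω ⊆ ball c R) (hpc : ‖p - c‖ = R) :
    ∀ ε > (0 : ℝ), ∃ r > (0 : ℝ),
      ∀ q ∈ Ω ∩ ball p r, 1 - ε < squeezingFun n Ω q := by
  intro ε hε
  have hpball : p ∈ ball p r₀ := mem_ball_self hr₀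
  have hρp : ContDiffAt ℝ 2 ρ p := hρ.contDiffAt (ball_mem_nhds p hr₀)
  have hiff : ∀ x ∈ ball p r₀, (x ∈ Ω ↔ ρ x < 0) := fun x hx =>
    ⟨fun h => (hdef.subset ⟨h, hx⟩).1, fun h => (hdef.symm.subset ⟨h, hx⟩).1⟩
  have hΩ : ∀ᶠ x in nhds p, x ∈ Ω ↔ ρ x < 0 := by
    filter_upwards [ball_mem_nhds p hr₀] with x hx using hiff x hx
  rw [hopen.frontier_eq] at hp
  have hp0 : ρ p = 0 := by
    refine le_antisymm (le_of_not_gt fun hpos => ?_)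
      (not_lt.1 fun hneg => hp.2 ((hiff p hpball).2 hneg))
    obtain ⟨x, hx, hxρ, hxiff⟩ := ((mem_closure_iff_frequently.1 hp.1).and_eventually
      ((hρp.continuousAt.eventually_const_lt hpos).and hΩ)).exists
    exact (hxρ.trans (hxiff.1 hx)).false
  set ε' := min (1 / 4) (ε / 8) with hε'def
  have hε' : 0 < ε' := by positivity
  have h4 : ε' ≤ 1 / 4 := min_le_left _ _
  have h8 : ε' ≤ ε / 8 := min_le_right _ _
  obtain ⟨e, he, r, hr, H⟩ := exists_map_near_ball_of_supported hρp hp0 (hgrad p hpball) hΩ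
    (hpc ▸ hΩball) hε'
  refine ⟨r, hr, fun q hq => ?_⟩
  obtain ⟨F, hFd, hFi, hF1, hF2, hFq⟩ := H q hq
  refine lt_of_lt_of_le ?_ (le_squeezingFun he hε' (by linarith) hFd hFi hF1 hF2 hFq)
  rw [lt_div_iff₀ (by positivity)]
  nlinarith [mul_pos hε hε']
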